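/- arXiv:1908.03384 — 2 statements merged into one kernel-verified Lean document; each statement's English description precedes it below -/
import Mathlib

section
/- Let n ≥ 2 and 1 ≤ m < n, and let ρ_Y be a rearrangement-invariant function norm on (0,∞), with associate norm ρ_Y' and fundamental function φ(t) = ρ_Y(χ_{(0,t)}). Let T_{m/n} f(t) = t^{−m/n} sup_{t ≤ s < ∞} s^{m/n} f^*(s), and define τ_m(f) = sup{ ρ_Y(t ↦ ∫_t^∞ h(s) s^{m/n−1} ds) : h ≥ 0 measurable with h^* = f^* }. If T_{m/n} is bounded on ρ_Y', i.e. there is K with ρ_Y'(T_{m/n} f) ≤ K ρ_Y'(f) for all measurable f, then inf_{1≤t<∞} t^{1−m/n}/φ(t) > 0 and there are constants c, C > 0 independent of f such that c · ρ_Y(t ↦ ∫_t^∞ f^*(s) s^{m/n−1} ds) ≤ τ_m(f) ≤ C · ρ_Y(t ↦ ∫_t^∞ f^*(s) s^{m/n−1} ds) for all nonnegative measurable f on (0,∞). Conversely, if T_{m/n} is not bounded on ρ_Y', then τ_m is not equivalent to the functional f ↦ ρ_Y(t ↦ ∫_t^∞ f^*(s) s^{m/n−1} ds). -/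
open MeasureTheory Set Filter
open scoped ENNReal NNReal Topology

noncomputable section

/-- Lebesgue measure restricted to `(0,∞)`. -/
def mu0 : Measure ℝ := volume.restrict (Set.Ioi (0:ℝ))

/-- Decreasing rearrangement of an `ℝ≥0∞`-valued function w.r.t. a measure `μ`. -/
def rearrangement {α : Type*} [MeasurableSpace α] (μ : Measure α) (f : α → ℝ≥0∞) (t : ℝ) :
    ℝ≥0∞ :=
  sInf {l : ℝ≥0∞ | μ {x | l < f x} ≤ ENNReal.ofReal t}

/-- Decreasing rearrangement of a (nonnegative) function on `(0,∞)`. -/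
def rearr (f : ℝ → ℝ≥0∞) : ℝ → ℝ≥0∞ := rearrangement mu0 f

/-- The maximal rearrangement `f^{**}(t) = (1/t)∫_0^t f^*(s) ds`. -/
def doubleStar (f : ℝ → ℝ≥0∞) (t : ℝ) : ℝ≥0∞ :=
  (ENNReal.ofReal t)⁻¹ * ∫⁻ s in Set.Ioc (0:ℝ) t, rearr f s

/-- Rearrangement-invariant function norm on `(0,∞)` (axioms (P1)–(P6)). -/
structure IsRINorm (ρ : (ℝ → ℝ≥0∞) → ℝ≥0∞) : Prop where
  eq_zero_iff : ∀ f : ℝ → ℝ≥0∞, Measurable f → (ρ f = 0 ↔ f =ᵐ[mu0] 0)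
  smul : ∀ (c : ℝ≥0) (f : ℝ → ℝ≥0∞), Measurable f →
    ρ (fun t => (c : ℝ≥0∞) * f t) = c * ρ f
  triangle : ∀ f g : ℝ → ℝ≥0∞, Measurable f → Measurable g → ρ (f + g) ≤ ρ f + ρ g
  mono : ∀ f g : ℝ → ℝ≥0∞, Measurable f → Measurable g →
    (∀ᵐ t ∂mu0, f t ≤ g t) → ρ f ≤ ρ g
  fatou : ∀ (F : ℕ → ℝ → ℝ≥0∞) (f : ℝ → ℝ≥0∞), (∀ j, Measurable (F j)) → Measurable f →
    (∀ j t, F j t ≤ F (j + 1) t) → (∀ t, (⨆ j, F j t) = f t) → (⨆ j, ρ (F j)) = ρ f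
  indicator_lt_top : ∀ E : Set ℝ, MeasurableSet E → mu0 E < ∞ → ρ (E.indicator 1) < ∞
  local_L1 : ∀ E : Set ℝ, MeasurableSet E → mu0 E < ∞ → ∃ C : ℝ≥0∞, 0 < C ∧ C < ∞ ∧
    ∀ f : ℝ → ℝ≥0∞, Measurable f → (∫⁻ t in E, f t ∂mu0) ≤ C * ρ f
  rearr_inv : ∀ f g : ℝ → ℝ≥0∞, Measurable f → Measurable g → rearr f = rearr g → ρ f = ρ g

/-- The associate norm `ρ'`. -/
def associate (ρ : (ℝ → ℝ≥0∞) → ℝ≥0∞) (g : ℝ → ℝ≥0∞) : ℝ≥0∞ :=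
  ⨆ (f : ℝ → ℝ≥0∞) (_ : Measurable f) (_ : ρ f ≤ 1), ∫⁻ t, f t * g t ∂mu0

/-- The weighted Hardy-type operator `f ↦ (t ↦ ∫_t^∞ f(s) s^{m/n-1} ds)`. -/
def hardyOp (m n : ℕ) (f : ℝ → ℝ≥0∞) (t : ℝ) : ℝ≥0∞ :=
  ∫⁻ s in Set.Ioi t, f s * ENNReal.ofReal (s ^ ((m : ℝ)/(n : ℝ) - 1))

/-- The function `t ↦ t^{m/n-1} χ_{(1,∞)}(t)`. -/
def tailFun (m n : ℕ) (t : ℝ) : ℝ≥0∞ :=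
  ENNReal.ofReal (t ^ ((m : ℝ)/(n : ℝ) - 1)) * (Set.Ioi (1:ℝ)).indicator 1 t

/-- The functional `σ_m(f) = ρ'(t ↦ t^{m/n} f^{**}(t))`. -/
def sigmaFun (m n : ℕ) (ρ : (ℝ → ℝ≥0∞) → ℝ≥0∞) (f : ℝ → ℝ≥0∞) : ℝ≥0∞ :=
  associate ρ (fun t => ENNReal.ofReal (t ^ ((m : ℝ)/(n : ℝ))) * doubleStar f t)

/-- The optimal-domain functional `τ_m`. -/
def tauFun (m n : ℕ) (ρY : (ℝ → ℝ≥0∞) → ℝ≥0∞) (f : ℝ → ℝ≥0∞) : ℝ≥0∞ :=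
  ⨆ (h : ℝ → ℝ≥0∞) (_ : Measurable h) (_ : rearr h = rearr f), ρY (hardyOp m n h)

/-- The operator `T_α f(t) = t^{-α} sup_{t ≤ s} s^α f^*(s)`. -/
def supOp (α : ℝ) (f : ℝ → ℝ≥0∞) (t : ℝ) : ℝ≥0∞ :=
  ENNReal.ofReal (t ^ (-α)) * ⨆ (s : ℝ) (_ : t ≤ s), ENNReal.ofReal (s ^ α) * rearr f s

/-- `σ` is an optimal (smallest) rearrangement-invariant target norm for `ρX` in the
Hardy-type inequality `‖∫_t^∞ f(s) s^{m/n-1} ds‖_Y ≤ C ‖f‖_X`. -/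
def IsOptimalTargetNorm (m n : ℕ) (ρX σ : (ℝ → ℝ≥0∞) → ℝ≥0∞) : Prop :=
  (∃ C : ℝ≥0∞, 0 < C ∧ C < ∞ ∧
      ∀ f : ℝ → ℝ≥0∞, Measurable f → σ (hardyOp m n f) ≤ C * ρX f) ∧
  ∀ ρZ : (ℝ → ℝ≥0∞) → ℝ≥0∞, IsRINorm ρZ →
    (∃ C : ℝ≥0∞, 0 < C ∧ C < ∞ ∧
       ∀ f : ℝ → ℝ≥0∞, Measurable f → ρZ (hardyOp m n f) ≤ C * ρX f) →
    ∃ c : ℝ≥0∞, 0 < c ∧ c < ∞ ∧ ∀ f : ℝ → ℝ≥0∞, Measurable f → ρZ f ≤ c * σ f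

/-- There exists a rearrangement-invariant target norm for `ρX` in the Hardy-type
inequality. -/
def ExistsRITarget (m n : ℕ) (ρX : (ℝ → ℝ≥0∞) → ℝ≥0∞) : Prop :=
  ∃ (ρY : (ℝ → ℝ≥0∞) → ℝ≥0∞) (C : ℝ≥0∞), IsRINorm ρY ∧ 0 < C ∧ C < ∞ ∧
    ∀ f : ℝ → ℝ≥0∞, Measurable f → ρY (hardyOp m n f) ≤ C * ρX f

/-- There exists a rearrangement-invariant domain norm for `ρY` in the Hardy-type
inequality. -/
def ExistsRIDomain (m n : ℕ) (ρY : (ℝ → ℝ≥0∞) → ℝ≥0∞) : Prop :=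
  ∃ (ρX : (ℝ → ℝ≥0∞) → ℝ≥0∞) (C : ℝ≥0∞), IsRINorm ρX ∧ 0 < C ∧ C < ∞ ∧
    ∀ f : ℝ → ℝ≥0∞, Measurable f → ρY (hardyOp m n f) ≤ C * ρX f

/-- Two functionals are equivalent with constants independent of the function. -/
def EquivNorms (σ τ : (ℝ → ℝ≥0∞) → ℝ≥0∞) : Prop :=
  ∃ c C : ℝ≥0∞, 0 < c ∧ c < ∞ ∧ 0 < C ∧ C < ∞ ∧
    ∀ f : ℝ → ℝ≥0∞, Measurable f → c * σ f ≤ τ f ∧ τ f ≤ C * σ f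

/-- The decay condition defining `V_0^m X(ℝ^n)`: all derivatives of order `< m` have
finite-measure superlevel sets. -/
def DecaysAtInfinity (n m : ℕ) (u : EuclideanSpace ℝ (Fin n) → ℝ) : Prop :=
  ∀ k : ℕ, k < m → ∀ lam : ℝ, 0 < lam →
    volume {x : EuclideanSpace ℝ (Fin n) | lam < ‖iteratedFDeriv ℝ k u x‖} < ∞

/-- Broken logarithm `ℓ^{[a₀,a_∞]}`. -/
def ell (a0 ai : ℝ) (t : ℝ) : ℝ :=
  if t < 1 then (1 - Real.log t) ^ a0 else (1 + Real.log t) ^ ai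

/-- Doubly broken logarithm `ℓℓ^{[b₀,b_∞]}`. -/
def ell2 (b0 bi : ℝ) (t : ℝ) : ℝ :=
  if t < 1 then (1 + Real.log (1 - Real.log t)) ^ b0
  else (1 + Real.log (1 + Real.log t)) ^ bi

/-- Triply broken logarithm `ℓℓℓ^{[c₀,c_∞]}`. -/
def ell3 (c0 ci : ℝ) (t : ℝ) : ℝ :=
  if t < 1 then (1 + Real.log (1 + Real.log (1 - Real.log t))) ^ c0
  else (1 + Real.log (1 + Real.log (1 + Real.log t))) ^ ci

/-- `L^q`-functional (`q ∈ [1,∞]`) of an `ℝ≥0∞`-valued function over `S ⊆ ℝ`. -/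
def Lqnorm (q : ℝ≥0∞) (S : Set ℝ) (g : ℝ → ℝ≥0∞) : ℝ≥0∞ :=
  if q = ∞ then essSup g (volume.restrict S)
  else (∫⁻ t in S, g t ^ q.toReal) ^ (1 / q.toReal)

/-- Lorentz–Zygmund functional `‖f‖_{p,q;[a₀,a_∞]}`, parametrized by `pinv = 1/p`. -/
def LZnorm (pinv : ℝ) (q : ℝ≥0∞) (a0 ai : ℝ) (f : ℝ → ℝ≥0∞) : ℝ≥0∞ :=
  Lqnorm q (Set.Ioi 0)
    (fun t => ENNReal.ofReal (t ^ (pinv - q⁻¹.toReal) * ell a0 ai t) * rearr f t)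

/-- Generalized Lorentz–Zygmund functional with two tiers of logarithms. -/
def GLZnorm2 (pinv : ℝ) (q : ℝ≥0∞) (a0 ai b0 bi : ℝ) (f : ℝ → ℝ≥0∞) : ℝ≥0∞ :=
  Lqnorm q (Set.Ioi 0)
    (fun t => ENNReal.ofReal (t ^ (pinv - q⁻¹.toReal) * ell a0 ai t * ell2 b0 bi t) * rearr f t)

/-- Generalized Lorentz–Zygmund functional with three tiers of logarithms. -/
def GLZnorm3 (pinv : ℝ) (q : ℝ≥0∞) (a0 ai b0 bi c0 ci : ℝ) (f : ℝ → ℝ≥0∞) : ℝ≥0∞ :=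
  Lqnorm q (Set.Ioi 0)
    (fun t => ENNReal.ofReal
      (t ^ (pinv - q⁻¹.toReal) * ell a0 ai t * ell2 b0 bi t * ell3 c0 ci t) * rearr f t)

/-- Young function predicate. -/
structure IsYoung (A : ℝ → ℝ≥0∞) : Prop where
  map_zero : A 0 = 0
  convex : ∀ x y : ℝ, 0 ≤ x → 0 ≤ y → ∀ l : ℝ, 0 ≤ l → l ≤ 1 →
    A (l * x + (1 - l) * y) ≤ ENNReal.ofReal l * A x + ENNReal.ofReal (1 - l) * A y
  left_cont : ∀ x : ℝ, 0 < x → Filter.Tendsto A (nhdsWithin x (Set.Iio x)) (nhds (A x))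
  not_zero : ∃ x : ℝ, 0 < x ∧ A x ≠ 0
  not_top : ∃ x : ℝ, 0 < x ∧ A x ≠ ∞

/-- Canonical extension of a Young function to `ℝ≥0∞`-valued arguments. -/
def eext (A : ℝ → ℝ≥0∞) (x : ℝ≥0∞) : ℝ≥0∞ := if x = ∞ then ∞ else A x.toReal

/-- Luxemburg norm on `(0,∞)`. -/
def luxNorm (A : ℝ → ℝ≥0∞) (f : ℝ → ℝ≥0∞) : ℝ≥0∞ :=
  sInf {l : ℝ≥0∞ | l ≠ 0 ∧ (∫⁻ t in Set.Ioi (0:ℝ), eext A (f t / l)) ≤ 1}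

/-- Generalized (right-continuous) inverse of a nondecreasing `g : ℝ → ℝ≥0∞`. -/
def geninv (g : ℝ → ℝ≥0∞) (y : ℝ≥0∞) : ℝ≥0∞ :=
  ⨅ (s : ℝ) (_ : 0 ≤ s) (_ : y ≤ g s), ENNReal.ofReal s

/-- Young conjugate `Ã(t) = sup_{s ≥ 0} (st - A(s))`. -/
def conjY (A : ℝ → ℝ≥0∞) (t : ℝ) : ℝ≥0∞ :=
  ⨆ (s : ℝ) (_ : 0 ≤ s), (ENNReal.ofReal (s * t) - A s)

/-- `h_A(t) = sup_{0<s<∞} A^{-1}(st)/A^{-1}(s)`. -/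
def hYoung (A : ℝ → ℝ≥0∞) (t : ℝ) : ℝ≥0∞ :=
  ⨆ (s : ℝ) (_ : 0 < s), geninv A (ENNReal.ofReal (s * t)) / geninv A (ENNReal.ofReal s)

/-- The upper Boyd index `I_A = inf_{0<t<1} log t / log h_A(t)`. -/
def upperBoyd (A : ℝ → ℝ≥0∞) : ℝ :=
  sInf ((fun t => Real.log t / Real.log ((hYoung A t).toReal)) '' Set.Ioo (0:ℝ) 1)

/-- `H_m(t) = (∫_0^t (s/A(s))^{m/(n-m)} ds)^{(n-m)/n}`. -/
def Hm (m n : ℕ) (A : ℝ → ℝ≥0∞) (t : ℝ) : ℝ≥0∞ :=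
  (∫⁻ s in Set.Ioc (0:ℝ) t, (ENNReal.ofReal s / A s) ^ ((m : ℝ)/((n : ℝ) - (m : ℝ))))
    ^ (((n : ℝ) - (m : ℝ))/(n : ℝ))

/-- `H^∞ = lim_{t→∞} H_m(t)`. -/
def Hinfty (m n : ℕ) (A : ℝ → ℝ≥0∞) : ℝ≥0∞ := ⨆ t : ℝ, Hm m n A t

/-- `D_m`. -/
def Dm (m n : ℕ) (A : ℝ → ℝ≥0∞) (t : ℝ) : ℝ≥0∞ :=
  if ENNReal.ofReal t < Hinfty m n A then
    (ENNReal.ofReal t * A ((geninv (Hm m n A) (ENNReal.ofReal t)).toReal) /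
        geninv (Hm m n A) (ENNReal.ofReal t)) ^ ((n : ℝ)/((n : ℝ) - (m : ℝ)))
  else ∞

/-- `A_m(t) = ∫_0^t D_m(s)/s ds`. -/
def Am (m n : ℕ) (A : ℝ → ℝ≥0∞) (t : ℝ) : ℝ≥0∞ :=
  ∫⁻ s in Set.Ioc (0:ℝ) t, Dm m n A s / ENNReal.ofReal s

/-- `G_m(t) = t · inf_{0<s≤t} B^{-1}(s) s^{(m-n)/n}`. -/
def Gm (m n : ℕ) (B : ℝ → ℝ≥0∞) (t : ℝ) : ℝ≥0∞ :=
  ENNReal.ofReal t *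
    ⨅ (s : ℝ) (_ : 0 < s) (_ : s ≤ t),
      geninv B (ENNReal.ofReal s) * ENNReal.ofReal (s ^ (((m : ℝ) - (n : ℝ))/(n : ℝ)))

/-- `B_m(t) = ∫_0^t G_m^{-1}(s)/s ds`. -/
def Bm (m n : ℕ) (B : ℝ → ℝ≥0∞) (t : ℝ) : ℝ≥0∞ :=
  ∫⁻ s in Set.Ioc (0:ℝ) t, geninv (Gm m n B) (ENNReal.ofReal s) / ENNReal.ofReal s

/-- `A` dominates `B` near zero. -/
def DomNearZero (A B : ℝ → ℝ≥0∞) : Prop :=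
  ∃ c t0 : ℝ, 0 < c ∧ 0 < t0 ∧ ∀ t : ℝ, 0 ≤ t → t ≤ t0 → B t ≤ A (c * t)

/-- `A` dominates `B` near infinity. -/
def DomNearInfty (A B : ℝ → ℝ≥0∞) : Prop :=
  ∃ c t0 : ℝ, 0 < c ∧ 0 < t0 ∧ ∀ t : ℝ, t0 ≤ t → B t ≤ A (c * t)

def EquivNearZero (A B : ℝ → ℝ≥0∞) : Prop := DomNearZero A B ∧ DomNearZero B A

def EquivNearInfty (A B : ℝ → ℝ≥0∞) : Prop := DomNearInfty A B ∧ DomNearInfty B A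

/-- There exists an Orlicz target for the Hardy-type inequality with domain `L^A`. -/
def ExistsOrliczTarget (m n : ℕ) (A : ℝ → ℝ≥0∞) : Prop :=
  ∃ B : ℝ → ℝ≥0∞, IsYoung B ∧ ∃ C : ℝ≥0∞, 0 < C ∧ C < ∞ ∧
    ∀ f : ℝ → ℝ≥0∞, Measurable f → luxNorm B (hardyOp m n f) ≤ C * luxNorm A f

/-- There exists an Orlicz domain for the Hardy-type inequality with target `L^B`. -/
def ExistsOrliczDomain (m n : ℕ) (B : ℝ → ℝ≥0∞) : Prop :=
  ∃ A : ℝ → ℝ≥0∞, IsYoung A ∧ ∃ C : ℝ≥0∞, 0 < C ∧ C < ∞ ∧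
    ∀ f : ℝ → ℝ≥0∞, Measurable f → luxNorm B (hardyOp m n f) ≤ C * luxNorm A f

/-- `L^{A_m}` is the optimal (smallest) Orlicz target for `L^A`. -/
def IsOptimalOrliczTarget (m n : ℕ) (A B : ℝ → ℝ≥0∞) : Prop :=
  (∃ C : ℝ≥0∞, 0 < C ∧ C < ∞ ∧
      ∀ f : ℝ → ℝ≥0∞, Measurable f → luxNorm B (hardyOp m n f) ≤ C * luxNorm A f) ∧
  ∀ B' : ℝ → ℝ≥0∞, IsYoung B' →
    (∃ C : ℝ≥0∞, 0 < C ∧ C < ∞ ∧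
       ∀ f : ℝ → ℝ≥0∞, Measurable f → luxNorm B' (hardyOp m n f) ≤ C * luxNorm A f) →
    ∃ c : ℝ≥0∞, 0 < c ∧ c < ∞ ∧
      ∀ g : ℝ → ℝ≥0∞, Measurable g → luxNorm B' g ≤ c * luxNorm B g

/-- Model Young-function behaviour `t^p (1 - log t)^a` (near zero). -/
def modelZero (p a : ℝ) (t : ℝ) : ℝ≥0∞ := ENNReal.ofReal (t ^ p * (1 - Real.log t) ^ a)

/-- Model Young-function behaviour `t^p (1 + log t)^a` (near infinity). -/
def modelInf (p a : ℝ) (t : ℝ) : ℝ≥0∞ := ENNReal.ofReal (t ^ p * (1 + Real.log t) ^ a)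



lemma mu0_apply_inter (s : Set ℝ) (hs : MeasurableSet s) : mu0 s = volume (s ∩ Ioi 0) := by
  unfold mu0; rw [Measure.restrict_apply hs]

lemma ofReal_lt_iff' (d : ℝ≥0∞) (hd : d ≠ ∞) (s : ℝ) (hs : 0 < s) :
    ENNReal.ofReal s < d ↔ s < d.toReal := by
  rw [ENNReal.ofReal_lt_iff_lt_toReal hs.le hd]

lemma meas_init (d : ℝ≥0∞) : MeasurableSet {s : ℝ | ENNReal.ofReal s < d} :=
  measurableSet_lt ENNReal.measurable_ofReal measurable_const

lemma mu0_init (d : ℝ≥0∞) : mu0 {s : ℝ | ENNReal.ofReal s < d} = d := by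
  rw [mu0_apply_inter _ (meas_init d)]
  by_cases hd : d = ∞
  · subst hd
    simp
  · have : {s : ℝ | ENNReal.ofReal s < d} ∩ Ioi 0 = Ioo 0 d.toReal := by
      ext s
      constructor
      · rintro ⟨h1, h2⟩
        exact ⟨h2, (ofReal_lt_iff' d hd s h2).1 h1⟩
      · rintro ⟨h1, h2⟩
        exact ⟨(ofReal_lt_iff' d hd s h1).2 h2, h1⟩
    rw [this, Real.volume_Ioo, sub_zero, ENNReal.ofReal_toReal hd]

lemma rearr_antitone (f : ℝ → ℝ≥0∞) : Antitone (rearr f) := by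
  intro a b hab
  unfold rearr rearrangement
  apply sInf_le_sInf
  intro l hl
  exact le_trans hl (ENNReal.ofReal_le_ofReal hab)

lemma rearr_meas (f : ℝ → ℝ≥0∞) : Measurable (rearr f) := (rearr_antitone f).measurable

lemma rearr_le {f : ℝ → ℝ≥0∞} {t : ℝ} {l : ℝ≥0∞} (h : mu0 {x | l < f x} ≤ ENNReal.ofReal t) :
    rearr f t ≤ l := sInf_le h

lemma mu0_rearr_lt (f : ℝ → ℝ≥0∞) (t : ℝ) :
    mu0 {x | rearr f t < f x} ≤ ENNReal.ofReal t := by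
  obtain ⟨u, hu1, hu2, hu3⟩ := exists_seq_tendsto_sInf
    (S := {l : ℝ≥0∞ | mu0 {x | l < f x} ≤ ENNReal.ofReal t}) ⟨⊤, by simp⟩ ⟨0, by simp [lowerBounds]⟩
  have : {x | rearr f t < f x} = ⋃ n, {x | u n < f x} := by
    ext x
    simp only [mem_ofPred_eq, mem_iUnion]
    constructor
    · intro h
      exact (((tendsto_order.1 hu2).2 _ h).exists)
    · rintro ⟨n, hn⟩
      exact lt_of_le_of_lt (sInf_le (hu3 n)) hn
  rw [this, Monotone.measure_iUnion]
  · exact iSup_le hu3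
  · intro a b hab x hx
    exact lt_of_le_of_lt (hu1 hab) hx

lemma lt_rearr_iff (f : ℝ → ℝ≥0∞) (t : ℝ) (l : ℝ≥0∞) :
    l < rearr f t ↔ ENNReal.ofReal t < mu0 {x | l < f x} := by
  constructor
  · intro h
    by_contra h2
    exact absurd (rearr_le (not_lt.1 h2)) (not_le.2 h)
  · intro h
    by_contra h2
    have h3 : mu0 {x | l < f x} ≤ mu0 {x | rearr f t < f x} :=
      measure_mono (fun x hx => lt_of_le_of_lt (not_lt.1 h2) hx)
    exact absurd (h3.trans (mu0_rearr_lt f t)) (not_le.2 h)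

lemma rearr_level (f : ℝ → ℝ≥0∞) (l : ℝ≥0∞) :
    {s : ℝ | l < rearr f s} = {s | ENNReal.ofReal s < mu0 {x | l < f x}} := by
  ext s; exact lt_rearr_iff f s l

lemma rearr_dist (f : ℝ → ℝ≥0∞) (l : ℝ≥0∞) :
    mu0 {s : ℝ | l < rearr f s} = mu0 {x | l < f x} := by
  rw [rearr_level, mu0_init]

lemma rearr_rearr (f : ℝ → ℝ≥0∞) : rearr (rearr f) = rearr f := by
  funext t
  have : {l : ℝ≥0∞ | mu0 {x | l < rearr f x} ≤ ENNReal.ofReal t} =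
    {l : ℝ≥0∞ | mu0 {x | l < f x} ≤ ENNReal.ofReal t} := by
    ext l; simp only [mem_ofPred_eq]; rw [rearr_dist]
  show sInf _ = sInf _
  rw [this]

lemma rearr_le_of_antitone {h : ℝ → ℝ≥0∞} (hh : AntitoneOn h (Ioi 0)) (t : ℝ) (ht : 0 < t) :
    rearr h t ≤ h t := by
  apply rearr_le
  unfold mu0
  rw [Measure.restrict_apply' measurableSet_Ioi]
  have : {x | h t < h x} ∩ Ioi 0 ⊆ Ioo 0 t := by
    rintro x ⟨h1, h2⟩
    refine ⟨h2, ?_⟩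
    by_contra h3
    exact absurd (hh ht h2 (not_lt.1 h3)) (not_le.2 h1)
  calc _ ≤ volume (Ioo 0 t) := measure_mono this
    _ = _ := by simp

lemma layer_pt (y : ℝ≥0∞) :
    ∫⁻ l in Ioi (0:ℝ), ({l : ℝ | ENNReal.ofReal l < y}.indicator 1 l : ℝ≥0∞) = y := by
  rw [lintegral_indicator_one (meas_init y)]
  exact mu0_init y

lemma layer_cake (g p : ℝ → ℝ≥0∞) (hg : Measurable g) (hp : Measurable p) :
    ∫⁻ x, g x * p x ∂mu0 =
      ∫⁻ l in Ioi (0:ℝ), ∫⁻ x in {x | ENNReal.ofReal l < g x}, p x ∂mu0 := by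
  have hm : MeasurableSet {q : ℝ × ℝ | ENNReal.ofReal q.2 < g q.1} :=
    measurableSet_lt (by fun_prop) (by fun_prop)
  have : SFinite mu0 := by unfold mu0; infer_instance
  calc ∫⁻ x, g x * p x ∂mu0
      = ∫⁻ x, (∫⁻ l in Ioi (0:ℝ), {q : ℝ × ℝ | ENNReal.ofReal q.2 < g q.1}.indicator
          (fun q => p q.1) (x, l)) ∂mu0 := by
        congr 1; funext x
        conv_lhs => rw [← layer_pt (g x)]
        rw [← lintegral_mul_const _ (measurable_one.indicator (meas_init _))]
        congr 1; funext l
        by_cases h : ENNReal.ofReal l < g x <;> simp [indicator, h]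
    _ = ∫⁻ l in Ioi (0:ℝ), ∫⁻ x, {q : ℝ × ℝ | ENNReal.ofReal q.2 < g q.1}.indicator
          (fun q => p q.1) (x, l) ∂mu0 := by
        rw [lintegral_lintegral_swap]
        exact (Measurable.indicator (f := fun q : ℝ × ℝ => p q.1) (by fun_prop) hm).aemeasurable
    _ = _ := by
        congr 1; funext l
        rw [← lintegral_indicator (measurableSet_lt measurable_const hg)]
        rfl

lemma HL_set (E : Set ℝ) (hE : MeasurableSet E) (p : ℝ → ℝ≥0∞) (hp : AntitoneOn p (Ioi 0)) :
    ∫⁻ x in E, p x ∂mu0 ≤ ∫⁻ x in {s : ℝ | ENNReal.ofReal s < mu0 E}, p x ∂mu0 := by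
  set d := mu0 E with hd
  set I := {s : ℝ | ENNReal.ofReal s < d} with hI
  have hIm : MeasurableSet I := meas_init d
  by_cases hdt : d = ∞
  · have : I = univ := by ext; simp [hI, hdt]
    rw [this, Measure.restrict_univ]
    exact setLIntegral_le_lintegral _ _
  by_cases hd0 : d = 0
  · rw [setLIntegral_measure_zero _ _ (hd ▸ hd0)]; exact zero_le
  have hpos : 0 < d.toReal := ENNReal.toReal_pos hd0 hdt
  have hsd : mu0 (E \ I) = mu0 (I \ E) := by
    have h1 := measure_inter_add_sdiff (μ := mu0) E hIm
    have h2 := measure_inter_add_sdiff (μ := mu0) I hE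
    rw [inter_comm I E] at h2
    have h3 : mu0 I = d := mu0_init d
    have hfin : mu0 (E ∩ I) ≠ ∞ := ne_top_of_le_ne_top hdt (measure_mono inter_subset_left)
    rw [h3] at h2
    rw [← hd, ← h2] at h1
    exact (ENNReal.add_right_inj hfin).1 h1
  have hpos0 : ∀ᵐ x ∂mu0, 0 < x := by
    unfold mu0; exact ae_restrict_mem measurableSet_Ioi
  have e1 : ∫⁻ x in E \ I, p x ∂mu0 ≤ p d.toReal * mu0 (E \ I) := by
    rw [← setLIntegral_const]
    refine lintegral_mono_ae ?_
    filter_upwards [ae_restrict_mem (hE.diff hIm), ae_restrict_of_ae hpos0] with x hx hx0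
    apply hp hpos hx0
    by_contra h
    exact hx.2 ((ofReal_lt_iff' d hdt x hx0).2 (not_le.1 h))
  have e2 : p d.toReal * mu0 (I \ E) ≤ ∫⁻ x in I \ E, p x ∂mu0 := by
    rw [← setLIntegral_const]
    refine lintegral_mono_ae ?_
    filter_upwards [ae_restrict_mem (hIm.diff hE), ae_restrict_of_ae hpos0] with x hx hx0
    exact hp hx0 hpos ((ofReal_lt_iff' d hdt x hx0).1 hx.1).le
  rw [← lintegral_inter_add_sdiff p E hIm, ← lintegral_inter_add_sdiff p I hE, inter_comm I E]
  exact add_le_add le_rfl (e1.trans (hsd ▸ e2))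

lemma HL (h S : ℝ → ℝ≥0∞) (hh : Measurable h) (hS : Measurable S) (hSa : AntitoneOn S (Ioi 0)) :
    ∫⁻ x, h x * S x ∂mu0 ≤ ∫⁻ x, rearr h x * S x ∂mu0 := by
  rw [layer_cake _ _ hh hS, layer_cake _ _ (rearr_meas h) hS]
  refine lintegral_mono (fun l => ?_)
  rw [rearr_level]
  exact HL_set _ (measurableSet_lt measurable_const hh) _ hSa

lemma ae_pos : ∀ᵐ x ∂mu0, 0 < x := by
  unfold mu0; exact ae_restrict_mem measurableSet_Ioi

lemma setInt_le_rearr (g : ℝ → ℝ≥0∞) (hg : Measurable g) (s : ℝ) :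
    ∫⁻ x in Ioo 0 s, g x ≤ ∫⁻ x in Ioo 0 s, rearr g x := by
  have key : ∀ q : ℝ → ℝ≥0∞, ∫⁻ x, q x * (Iio s).indicator 1 x ∂mu0 = ∫⁻ x in Ioo 0 s, q x := by
    intro q
    have : ∀ x, q x * (Iio s).indicator 1 x = (Iio s).indicator q x := by
      intro x; by_cases h : x < s <;> simp [h]
    simp_rw [this]
    rw [lintegral_indicator measurableSet_Iio, mu0, Measure.restrict_restrict measurableSet_Iio]
    congr 2
    ext x; simp [and_comm]
  rw [← key, ← key]
  apply HL _ _ hg (measurable_one.indicator measurableSet_Iio)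
  intro a _ b _ hab
  by_cases h : b < s
  · simp [h, hab.trans_lt h]
  · simp [h]


lemma IsRINorm.zero {ρ : (ℝ → ℝ≥0∞) → ℝ≥0∞} (hY : IsRINorm ρ) : ρ (fun _ => 0) = 0 :=
  (hY.eq_zero_iff _ measurable_const).2 (Filter.Eventually.of_forall fun _ => rfl)

lemma le_associate {ρ : (ℝ → ℝ≥0∞) → ℝ≥0∞} (u g : ℝ → ℝ≥0∞) (hu : Measurable u) (h1 : ρ u ≤ 1) :
    ∫⁻ t, u t * g t ∂mu0 ≤ associate ρ g :=
  le_iSup_of_le u (le_iSup_of_le hu (le_iSup_of_le h1 le_rfl))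

lemma associate_le {ρ : (ℝ → ℝ≥0∞) → ℝ≥0∞} (g : ℝ → ℝ≥0∞) (B : ℝ≥0∞)
    (h : ∀ u, Measurable u → ρ u ≤ 1 → ∫⁻ t, u t * g t ∂mu0 ≤ B) : associate ρ g ≤ B :=
  iSup_le fun u => iSup_le fun hu => iSup_le fun h1 => h u hu h1

lemma holder {ρ : (ℝ → ℝ≥0∞) → ℝ≥0∞} (hY : IsRINorm ρ) (u g : ℝ → ℝ≥0∞) (hu : Measurable u)
    (hfin : ρ u ≠ ∞) : ∫⁻ t, u t * g t ∂mu0 ≤ ρ u * associate ρ g := by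
  by_cases h0 : ρ u = 0
  · have := (hY.eq_zero_iff u hu).1 h0
    have h2 : ∫⁻ t, u t * g t ∂mu0 = ∫⁻ t, 0 ∂mu0 := by
      apply lintegral_congr_ae
      filter_upwards [this] with x hx
      simp [hx]
    rw [h2]; simp
  · obtain ⟨c, hc⟩ : ∃ c : ℝ≥0, ρ u = c := ⟨(ρ u).toNNReal, (ENNReal.coe_toNNReal hfin).symm⟩
    have hc0 : c ≠ 0 := by rintro rfl; simp [hc] at h0
    have hc0' : (c : ℝ≥0∞) ≠ 0 := by exact_mod_cast hc0
    have h1 : ρ (fun t => ((c⁻¹ : ℝ≥0) : ℝ≥0∞) * u t) ≤ 1 := by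
      rw [hY.smul _ _ hu, hc, ← ENNReal.coe_mul, inv_mul_cancel₀ hc0]; simp
    have h2 := le_associate _ g (hu.const_mul _) h1
    rw [hc]
    calc ∫⁻ t, u t * g t ∂mu0 = ∫⁻ t, c * (((c⁻¹ : ℝ≥0) : ℝ≥0∞) * u t * g t) ∂mu0 := by
          congr 1; funext t
          rw [← mul_assoc, ← mul_assoc, ← ENNReal.coe_mul, mul_inv_cancel₀ hc0]; simp
      _ = c * ∫⁻ t, (((c⁻¹ : ℝ≥0) : ℝ≥0∞) * u t * g t) ∂mu0 :=
          lintegral_const_mul' _ _ ENNReal.coe_ne_top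
      _ ≤ _ := by gcongr

lemma rho_rearr {ρ : (ℝ → ℝ≥0∞) → ℝ≥0∞} (hY : IsRINorm ρ) (f : ℝ → ℝ≥0∞) (hf : Measurable f) :
    ρ (rearr f) = ρ f := hY.rearr_inv _ _ (rearr_meas f) hf (rearr_rearr f)

lemma rho_le_of_rearr_le {ρ : (ℝ → ℝ≥0∞) → ℝ≥0∞} (hY : IsRINorm ρ) (v u : ℝ → ℝ≥0∞)
    (hv : Measurable v) (hu : Measurable u) (h : ∀ t, 0 < t → rearr v t ≤ u t) : ρ v ≤ ρ u := by
  rw [← rho_rearr hY v hv]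
  apply hY.mono _ _ (rearr_meas v) hu
  filter_upwards [ae_pos] with t ht using h t ht

lemma rho_liminf {ρ : (ℝ → ℝ≥0∞) → ℝ≥0∞} (hY : IsRINorm ρ) (G : ℕ → ℝ → ℝ≥0∞)
    (hG : ∀ n, Measurable (G n)) (h1 : ∀ n, ρ (G n) ≤ 1) :
    ρ (fun x => liminf (fun n => G n x) atTop) ≤ 1 := by
  have := hY.fatou (fun n x => ⨅ i, G (i + n) x) (fun x => liminf (fun n => G n x) atTop)
    (fun n => .iInf fun i => hG _) (Measurable.liminf hG) (fun n x => ?_) (fun x => ?_)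
  · rw [← this]
    refine iSup_le fun n => le_trans ?_ (h1 n)
    apply hY.mono _ _ (.iInf fun i => hG _) (hG n)
    refine Eventually.of_forall fun x => ?_
    simpa using iInf_le (fun i => G (i + n) x) 0
  · refine le_iInf fun i => ?_
    have := iInf_le (fun i => G (i + n) x) (i + 1)
    simpa [add_assoc, add_comm 1 n] using this
  · exact (liminf_eq_iSup_iInf_of_nat' (u := fun n => G n x)).symm

/-- extension of an L2 function on `(0,k]` -/
def extf (k : ℝ) (u : ℝ → ℝ) (x : ℝ) : ℝ≥0∞ := (Iic k).indicator (fun x => ENNReal.ofReal |u x|) x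

def muk (k : ℝ) : Measure ℝ := mu0.restrict (Iic k)

instance muk_fin (k : ℝ) : IsFiniteMeasure (muk k) := by
  constructor
  unfold muk mu0
  rw [Measure.restrict_restrict measurableSet_Iic, Measure.restrict_apply MeasurableSet.univ,
    univ_inter]
  have : Iic k ∩ Ioi 0 ⊆ Icc 0 k := fun x hx => ⟨le_of_lt hx.2, hx.1⟩
  exact (measure_mono this).trans_lt (by simp)

lemma extf_meas (k : ℝ) (u : ℝ → ℝ) (hu : Measurable u) : Measurable (extf k u) :=
  Measurable.indicator (by fun_prop) measurableSet_Iic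

lemma ae_muk {k : ℝ} {P : ℝ → Prop} (h : ∀ᵐ x ∂(muk k), P x) : ∀ᵐ x ∂mu0, x ∈ Iic k → P x :=
  (ae_restrict_iff' measurableSet_Iic).1 h

def Bk (ρ : (ℝ → ℝ≥0∞) → ℝ≥0∞) (k : ℝ) : Set (Lp ℝ 2 (muk k)) := {u | ρ (extf k u) ≤ 1}

lemma Lp_meas {k : ℝ} (u : Lp ℝ 2 (muk k)) : Measurable (u : ℝ → ℝ) :=
  (Lp.stronglyMeasurable u).measurable

lemma Bk_convex {ρ : (ℝ → ℝ≥0∞) → ℝ≥0∞} (hY : IsRINorm ρ) (k : ℝ) : Convex ℝ (Bk ρ k) := by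
  intro u hu v hv a b ha hb hab
  have hu' := extf_meas k _ (Lp_meas u)
  have hv' := extf_meas k _ (Lp_meas v)
  have h1 : ρ (extf k (a • u + b • v : Lp ℝ 2 (muk k))) ≤
      ρ ((fun x => (a.toNNReal : ℝ≥0∞) * extf k u x) + (fun x => (b.toNNReal : ℝ≥0∞) * extf k v x)) := by
    apply hY.mono _ _ (extf_meas k _ (Lp_meas _)) ((hu'.const_mul _).add (hv'.const_mul _))
    filter_upwards [ae_muk (Lp.coeFn_add (a • u) (b • v)), ae_muk (Lp.coeFn_smul a u),
      ae_muk (Lp.coeFn_smul b v)] with x h1 h2 h3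
    by_cases hx : x ∈ Iic k
    · simp only [extf, hx, indicator_of_mem, Pi.add_apply]
      rw [h1 hx, Pi.add_apply, h2 hx, h3 hx]
      simp only [Pi.smul_apply, smul_eq_mul]
      change _ ≤ ENNReal.ofReal a * _ + ENNReal.ofReal b * _
      rw [← ENNReal.ofReal_mul ha, ← ENNReal.ofReal_mul hb, ← ENNReal.ofReal_add (by positivity) (by positivity)]
      apply ENNReal.ofReal_le_ofReal
      refine (abs_add_le _ _).trans ?_
      rw [abs_mul, abs_mul, abs_of_nonneg ha, abs_of_nonneg hb]
    · simp [extf, hx]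
  refine h1.trans ((hY.triangle _ _ (hu'.const_mul _) (hv'.const_mul _)).trans ?_)
  rw [hY.smul _ _ hu', hY.smul _ _ hv']
  calc (a.toNNReal : ℝ≥0∞) * ρ (extf k u) + (b.toNNReal : ℝ≥0∞) * ρ (extf k v)
      ≤ (a.toNNReal : ℝ≥0∞) * 1 + (b.toNNReal : ℝ≥0∞) * 1 := by
        gcongr
        · exact hu
        · exact hv
    _ = ENNReal.ofReal a + ENNReal.ofReal b := by simp [ENNReal.ofReal]
    _ = 1 := by rw [← ENNReal.ofReal_add ha hb, hab]; simp

lemma Bk_closed {ρ : (ℝ → ℝ≥0∞) → ℝ≥0∞} (hY : IsRINorm ρ) (k : ℝ) : IsClosed (Bk ρ k) := by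
  apply IsSeqClosed.isClosed
  intro u v hu huv
  obtain ⟨ns, hns, hae⟩ := (tendstoInMeasure_of_tendsto_Lp huv).exists_seq_tendsto_ae
  have h1 := rho_liminf hY (fun n => extf k (u (ns n))) (fun n => extf_meas k _ (Lp_meas _))
    (fun n => hu (ns n))
  refine le_trans ?_ h1
  apply hY.mono _ _ (extf_meas k _ (Lp_meas _))
    (Measurable.liminf fun n => extf_meas k _ (Lp_meas _))
  filter_upwards [ae_muk hae] with x hx
  by_cases hxk : x ∈ Iic k
  · simp only [extf, hxk, indicator_of_mem]
    have := (ENNReal.continuous_ofReal.tendsto _).comp ((hx hxk).abs)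
    exact (this.liminf_eq).symm.le
  · simp [extf, hxk]

lemma muk_lint (k : ℝ) (u p : ℝ → ℝ≥0∞) :
    ∫⁻ x, u x * (Iic k).indicator p x ∂mu0 = ∫⁻ x, u x * p x ∂(muk k) := by
  unfold muk
  rw [← lintegral_indicator measurableSet_Iic]
  congr 1; funext x
  by_cases hx : x ∈ Iic k <;> simp [hx]

lemma memLp_trunc (k : ℝ) (u : ℝ → ℝ≥0∞) (hu : Measurable u) (l : ℕ) (e : ℝ → ℝ) (he : Measurable e)
    (he1 : ∀ x, |e x| ≤ 1) :
    MemLp (fun x => e x * (min (u x) l).toReal) 2 (muk k) := by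
  apply MemLp.of_bound (C := l) (by fun_prop)
  refine Eventually.of_forall fun x => ?_
  rw [Real.norm_eq_abs, abs_mul, abs_of_nonneg (ENNReal.toReal_nonneg (a := min (u x) l))]
  have : (min (u x) l).toReal ≤ l := by
    apply ENNReal.toReal_le_of_le_ofReal (by positivity)
    simp
  calc _ ≤ 1 * (l:ℝ) := by gcongr; exact he1 x
    _ = l := one_mul _

lemma ofReal_min_toReal (a : ℝ≥0∞) (l : ℕ) : ENNReal.ofReal (min a l).toReal = min a l :=
  ENNReal.ofReal_toReal (ne_top_of_le_ne_top (ENNReal.natCast_ne_top l) (min_le_right _ _))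

lemma iSup_min_nat (a : ℝ≥0∞) : ⨆ l : ℕ, min a (l : ℝ≥0∞) = a := by
  rw [← inf_iSup_eq, ENNReal.iSup_natCast]; simp

lemma inner_real_mul (a b : ℝ) : inner ℝ a b = b * a := rfl

/-- Lorentz–Luxemburg, one direction. -/
lemma lorentz_luxemburg_one {ρ : (ℝ → ℝ≥0∞) → ℝ≥0∞} (hY : IsRINorm ρ) (f : ℝ → ℝ≥0∞)
    (hf : Measurable f)
    (h : ∀ g, Measurable g → associate ρ g ≤ 1 → ∫⁻ t, f t * g t ∂mu0 ≤ 1) : ρ f ≤ 1 := by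
  by_contra hcon
  have hcon := not_le.1 hcon
  have hmF : ∀ k : ℕ, Measurable ((Iic (k : ℝ)).indicator (fun x => min (f x) (k : ℝ≥0∞))) :=
    fun k => (hf.min measurable_const).indicator measurableSet_Iic
  obtain ⟨k, hk⟩ : ∃ k : ℕ, 1 < ρ ((Iic (k : ℝ)).indicator (fun x => min (f x) (k : ℝ≥0∞))) := by
    rw [← hY.fatou (fun k : ℕ => (Iic (k : ℝ)).indicator (fun x => min (f x) (k : ℝ≥0∞))) f hmF hf
      ?_ ?_] at hcon
    · exact lt_iSup_iff.1 hcon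
    · intro j t
      by_cases ht : t ≤ (j : ℝ)
      · have ht2 : t ≤ ((j + 1 : ℕ) : ℝ) := by push_cast; linarith
        simp only [mem_Iic, ht, ht2, indicator_of_mem]
        gcongr; simp
      · simp [ht]
    · intro t
      apply le_antisymm
      · refine iSup_le fun j => ?_
        by_cases ht : t ≤ (j : ℝ) <;> simp [ht]
      · conv_lhs => rw [← iSup_min_nat (f t)]
        refine iSup_le fun j => ?_
        obtain ⟨i, hi⟩ := exists_nat_ge t
        refine le_iSup_of_le (max i j) ?_
        have : t ≤ ((max i j : ℕ) : ℝ) := hi.trans (by exact_mod_cast le_max_left _ _)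
        simp only [mem_Iic, this, indicator_of_mem]
        gcongr
        exact_mod_cast le_max_right _ _
  have hm1 := memLp_trunc (k:ℝ) f hf k (fun _ => 1) measurable_const (by simp)
  set F : Lp ℝ 2 (muk (k:ℝ)) := hm1.toLp _ with hF
  have hFae : ∀ᵐ x ∂(muk (k:ℝ)), F x = (min (f x) k).toReal := by
    filter_upwards [hm1.coeFn_toLp] with x hx
    rw [hx, one_mul]
  have hFB : F ∉ Bk ρ k := by
    intro hmem
    refine absurd (le_trans ?_ hmem) (not_le.2 hk)
    apply hY.mono _ _ (hmF k) (extf_meas _ _ (Lp_meas _))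
    filter_upwards [ae_muk hFae] with x hx
    by_cases hxk : x ∈ Iic (k:ℝ)
    · simp only [extf, hxk, indicator_of_mem]
      rw [hx hxk, abs_of_nonneg ENNReal.toReal_nonneg, ofReal_min_toReal]
    · simp [extf, hxk]
  have h0B : (0 : Lp ℝ 2 (muk (k:ℝ))) ∈ Bk ρ k := by
    show ρ _ ≤ 1
    refine le_trans ?_ (hY.zero.le.trans zero_le_one)
    apply hY.mono _ _ (extf_meas _ _ (Lp_meas _)) measurable_const
    filter_upwards [ae_muk (Lp.coeFn_zero ℝ 2 (muk (k:ℝ)))] with x hx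
    by_cases hxk : x ∈ Iic (k:ℝ)
    · simp only [extf, hxk, indicator_of_mem]
      rw [hx hxk]; simp
    · simp [extf, hxk]
  obtain ⟨P, hPB, hP⟩ := exists_norm_eq_iInf_of_complete_convex ⟨0, h0B⟩ (Bk_closed hY k).isComplete
    (Bk_convex hY k) F
  rw [norm_eq_iInf_iff_real_inner_le_zero (Bk_convex hY k) hPB] at hP
  set q := F - P with hq
  have hq0 : q ≠ 0 := by
    intro h0
    rw [hq, sub_eq_zero] at h0
    exact hFB (h0 ▸ hPB)
  set γ : ℝ := inner ℝ q P with hγ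
  have hγ0 : 0 ≤ γ := by
    have := hP 0 h0B
    rw [inner_sub_right, inner_zero_right] at this
    linarith
  have hw : ∀ w ∈ Bk ρ k, inner ℝ q w ≤ γ := by
    intro w hw
    have := hP w hw
    rw [inner_sub_right] at this
    linarith
  have hqF : γ < inner ℝ q F := by
    have h1 : inner ℝ q q = inner ℝ q F - γ := by
      conv_lhs => rw [hq, inner_sub_right, ← hq]
    have h2 : 0 < inner ℝ q q := real_inner_self_pos.2 hq0
    linarith
  obtain ⟨δ, hδ1, hδ2⟩ := exists_between hqF
  have hδ0 : 0 < δ := hγ0.trans_lt hδ1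
  have hqm : Measurable (q : ℝ → ℝ) := Lp_meas q
  have hGm : Measurable (extf k q) := extf_meas _ _ hqm
  have hup : ∀ u, Measurable u → ρ u ≤ 1 → ∫⁻ t, u t * extf k q t ∂mu0 ≤ ENNReal.ofReal γ := by
    intro u hu hu1
    have hl : ∀ l : ℕ, ∫⁻ t, min (u t) l * extf k q t ∂mu0 ≤ ENNReal.ofReal γ := by
      intro l
      have hsm : Measurable (fun x => (SignType.sign (q x) : ℝ)) := by
        have : (fun x => (SignType.sign (q x) : ℝ)) = fun x => if 0 < q x then 1 else if q x < 0 then -1 else 0 := by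
          funext x
          simp only [sign_apply]
          split_ifs <;> simp
        rw [this]
        exact Measurable.ite (measurableSet_lt measurable_const hqm) measurable_const
          (Measurable.ite (measurableSet_lt hqm measurable_const) measurable_const measurable_const)
      have hsb : ∀ x, |(SignType.sign (q x) : ℝ)| ≤ 1 := by
        intro x
        rcases lt_trichotomy (q x) 0 with h | h | h <;> simp [h]
      have hm2 := memLp_trunc (k:ℝ) u hu l _ hsm hsb
      have hWB : hm2.toLp _ ∈ Bk ρ k := by
        refine le_trans ?_ hu1
        apply hY.mono _ _ (extf_meas _ _ (Lp_meas _)) hu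
        filter_upwards [ae_muk hm2.coeFn_toLp] with x hx
        by_cases hxk : x ∈ Iic (k:ℝ)
        · simp only [extf, hxk, indicator_of_mem]
          rw [hx hxk, abs_mul, abs_of_nonneg (ENNReal.toReal_nonneg (a := min (u x) l))]
          calc _ ≤ ENNReal.ofReal (1 * (min (u x) l).toReal) := by
                apply ENNReal.ofReal_le_ofReal
                gcongr; exact hsb x
            _ ≤ u x := by rw [one_mul, ofReal_min_toReal]; exact min_le_left _ _
        · simp [extf, hxk]
      have h3 := hw _ hWB
      rw [MeasureTheory.L2.inner_def] at h3
      have hIeq : ∫ x, inner ℝ (q x) ((hm2.toLp _ : Lp ℝ 2 (muk (k:ℝ))) x) ∂(muk (k:ℝ)) =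
          ∫ x, (min (u x) l).toReal * |q x| ∂(muk (k:ℝ)) := by
        apply integral_congr_ae
        filter_upwards [hm2.coeFn_toLp] with x hx
        rw [hx]
        rw [inner_real_mul]
        rw [show ∀ a b c : ℝ, a * b * c = b * (a * c) by intros; ring, sign_mul_self]
      have hii : Integrable (fun x => (min (u x) l).toReal * |q x|) (muk (k:ℝ)) := by
        have := MeasureTheory.L2.integrable_inner (𝕜 := ℝ) q (hm2.toLp _)
        refine this.congr ?_
        filter_upwards [hm2.coeFn_toLp] with x hx
        rw [hx]
        rw [inner_real_mul]
        rw [show ∀ a b c : ℝ, a * b * c = b * (a * c) by intros; ring, sign_mul_self]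
      rw [hIeq] at h3
      calc ∫⁻ t, min (u t) l * extf k q t ∂mu0 = ∫⁻ t, min (u t) l * ENNReal.ofReal |q t| ∂(muk k) :=
            muk_lint _ _ _
        _ = ∫⁻ t, ENNReal.ofReal ((min (u t) l).toReal * |q t|) ∂(muk k) := by
            congr 1; funext t
            rw [ENNReal.ofReal_mul ENNReal.toReal_nonneg, ofReal_min_toReal]
        _ = ENNReal.ofReal (∫ x, (min (u x) l).toReal * |q x| ∂(muk (k:ℝ))) := by
            rw [ofReal_integral_eq_lintegral_ofReal hii]
            exact Eventually.of_forall fun x => mul_nonneg ENNReal.toReal_nonneg (abs_nonneg _)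
        _ ≤ _ := ENNReal.ofReal_le_ofReal h3
    calc ∫⁻ t, u t * extf k q t ∂mu0 = ∫⁻ t, ⨆ l : ℕ, min (u t) l * extf k q t ∂mu0 := by
          congr 1; funext t
          rw [← ENNReal.iSup_mul, iSup_min_nat]
      _ = ⨆ l : ℕ, ∫⁻ t, min (u t) l * extf k q t ∂mu0 := by
          apply lintegral_iSup
          · intro l; exact (hu.min measurable_const).mul hGm
          · intro a b hab t
            dsimp only
            gcongr
      _ ≤ _ := iSup_le hl
  have hlow : ENNReal.ofReal δ < ∫⁻ t, f t * extf k q t ∂mu0 := by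
    rw [MeasureTheory.L2.inner_def] at hδ2
    have hii : Integrable (fun x => inner ℝ (q x) (F x)) (muk (k:ℝ)) :=
      MeasureTheory.L2.integrable_inner (𝕜 := ℝ) q F
    have hi2 : Integrable (fun x => (min (f x) k).toReal * |q x|) (muk (k:ℝ)) := by
      refine hii.abs.congr ?_
      filter_upwards [hFae] with x hx
      rw [hx]
      rw [inner_real_mul]
      rw [abs_mul, abs_of_nonneg (ENNReal.toReal_nonneg (a := min (f x) k))]
    have h4 : ∫ x, inner ℝ (q x) (F x) ∂(muk (k:ℝ)) ≤ ∫ x, (min (f x) k).toReal * |q x| ∂(muk (k:ℝ)) := by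
      apply integral_mono_ae hii hi2
      filter_upwards [hFae] with x hx
      rw [hx]
      rw [inner_real_mul]
      gcongr
      exact le_abs_self _
    calc ENNReal.ofReal δ < ENNReal.ofReal (∫ x, (min (f x) k).toReal * |q x| ∂(muk (k:ℝ))) := by
          rw [ENNReal.ofReal_lt_ofReal_iff (hδ0.trans (hδ2.trans_le h4))]
          exact hδ2.trans_le h4
      _ = ∫⁻ t, ENNReal.ofReal ((min (f t) k).toReal * |q t|) ∂(muk k) := by
            rw [ofReal_integral_eq_lintegral_ofReal hi2]
            exact Eventually.of_forall fun x => mul_nonneg ENNReal.toReal_nonneg (abs_nonneg _)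
      _ ≤ ∫⁻ t, f t * ENNReal.ofReal |q t| ∂(muk k) := by
            apply lintegral_mono; intro t
            dsimp only
            rw [ENNReal.ofReal_mul ENNReal.toReal_nonneg, ofReal_min_toReal]
            gcongr; exact min_le_left _ _
      _ = _ := (muk_lint _ _ _).symm
  have hδe : ENNReal.ofReal δ ≠ 0 := by simpa using hδ0
  have hconst : ∀ u : ℝ → ℝ≥0∞, ∫⁻ t, u t * ((ENNReal.ofReal δ)⁻¹ * extf k q t) ∂mu0 =
      (ENNReal.ofReal δ)⁻¹ * ∫⁻ t, u t * extf k q t ∂mu0 := by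
    intro u
    rw [← lintegral_const_mul' _ _ (ENNReal.inv_ne_top.2 hδe)]
    congr 1; funext t; ring
  have h5 := h (fun t => (ENNReal.ofReal δ)⁻¹ * extf k q t) (hGm.const_mul _) (by
    apply associate_le
    intro u hu hu1
    rw [hconst]
    calc _ ≤ (ENNReal.ofReal δ)⁻¹ * ENNReal.ofReal δ := by
          gcongr
          exact (hup u hu hu1).trans (ENNReal.ofReal_le_ofReal hδ1.le)
      _ = 1 := ENNReal.inv_mul_cancel hδe ENNReal.ofReal_ne_top)
  rw [hconst] at h5
  have h6 : (ENNReal.ofReal δ)⁻¹ * ENNReal.ofReal δ < (ENNReal.ofReal δ)⁻¹ * ∫⁻ t, f t * extf k q t ∂mu0 :=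
    (ENNReal.mul_lt_mul_iff_right (ENNReal.inv_ne_zero.2 ENNReal.ofReal_ne_top) (ENNReal.inv_ne_top.2 hδe)).2 hlow
  rw [ENNReal.inv_mul_cancel hδe ENNReal.ofReal_ne_top] at h6
  exact absurd h5 (not_le.2 h6)

lemma lorentz_luxemburg {ρ : (ℝ → ℝ≥0∞) → ℝ≥0∞} (hY : IsRINorm ρ) (f : ℝ → ℝ≥0∞)
    (hf : Measurable f) (B : ℝ≥0∞)
    (h : ∀ g, Measurable g → associate ρ g ≤ 1 → ∫⁻ t, f t * g t ∂mu0 ≤ B) : ρ f ≤ B := by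
  apply le_of_forall_gt_imp_ge_of_dense
  intro b hb
  by_cases hbt : b = ∞
  · simp [hbt]
  have hb0 : b ≠ 0 := (zero_le.trans_lt hb).ne'
  lift b to ℝ≥0 using hbt
  have hb0' : b ≠ 0 := by exact_mod_cast hb0
  have h1 := lorentz_luxemburg_one hY (fun t => ((b⁻¹ : ℝ≥0) : ℝ≥0∞) * f t) (hf.const_mul _) (by
    intro g hg hg1
    simp_rw [mul_assoc]
    rw [lintegral_const_mul' _ _ ENNReal.coe_ne_top, ENNReal.coe_inv hb0']
    calc _ ≤ (b : ℝ≥0∞)⁻¹ * b := by gcongr; exact (h g hg hg1).trans hb.le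
      _ = 1 := ENNReal.inv_mul_cancel hb0 ENNReal.coe_ne_top)
  rw [hY.smul _ _ hf] at h1
  calc ρ f = b * (((b⁻¹ : ℝ≥0) : ℝ≥0∞) * ρ f) := by
        rw [← mul_assoc, ← ENNReal.coe_mul, mul_inv_cancel₀ hb0']; simp
    _ ≤ b * 1 := by gcongr
    _ = b := mul_one _


lemma mu0_Ico_le (S : Set ℝ) (a b : ℝ) : mu0 (S ∩ Ico a b) ≤ ENNReal.ofReal (b - a) := by
  calc mu0 (S ∩ Ico a b) ≤ mu0 (Ico a b) := measure_mono inter_subset_right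
    _ ≤ volume (Ico a b) := by unfold mu0; exact Measure.restrict_apply_le _ _
    _ = _ := Real.volume_Ico

lemma mu0_Iio_lt_top (S : Set ℝ) (r : ℝ) : mu0 (S ∩ Iio r) < ∞ := by
  have h : mu0 (S ∩ Iio r) ≤ muk r univ := by
    unfold muk
    rw [Measure.restrict_apply MeasurableSet.univ, univ_inter]
    exact measure_mono (inter_subset_right.trans Iio_subset_Iic_self)
  exact h.trans_lt (measure_lt_top _ _)

lemma exists_subset_mu0 (S : Set ℝ) (hS : MeasurableSet S) (c : ℝ) (hc : 0 ≤ c)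
    (h : ENNReal.ofReal c < mu0 S) :
    ∃ E, MeasurableSet E ∧ E ⊆ S ∧ mu0 E = ENNReal.ofReal c := by
  set φ : ℝ → ℝ := fun r => (mu0 (S ∩ Iio r)).toReal with hφ
  have hlip : LipschitzWith 1 φ := by
    apply LipschitzWith.of_le_add
    intro x y
    rcases le_total x y with hxy | hxy
    · have : φ x ≤ φ y := ENNReal.toReal_mono (mu0_Iio_lt_top _ _).ne
        (measure_mono (inter_subset_inter_right _ (Iio_subset_Iio hxy)))
      linarith [dist_nonneg (x := x) (y := y)]
    · have h1 : S ∩ Iio x ⊆ (S ∩ Iio y) ∪ (S ∩ Ico y x) := by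
        rintro z ⟨hz1, hz2⟩
        by_cases hz : z < y
        · exact Or.inl ⟨hz1, hz⟩
        · exact Or.inr ⟨hz1, not_lt.1 hz, hz2⟩
      have h2 : mu0 (S ∩ Iio x) ≤ mu0 (S ∩ Iio y) + ENNReal.ofReal (x - y) :=
        (measure_mono h1).trans ((measure_union_le _ _).trans (by gcongr; exact mu0_Ico_le _ _ _))
      have h3 := ENNReal.toReal_mono (by simp [(mu0_Iio_lt_top S y).ne]) h2
      rw [ENNReal.toReal_add (mu0_Iio_lt_top _ _).ne ENNReal.ofReal_ne_top,
        ENNReal.toReal_ofReal (by linarith)] at h3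
      rw [Real.dist_eq, abs_of_nonneg (by linarith)]
      exact h3
  have hU : S = ⋃ n : ℕ, S ∩ Iio (n : ℝ) := by
    rw [← inter_iUnion]
    ext x
    simp only [mem_inter_iff, mem_iUnion, mem_Iio, iff_self_and]
    intro _; exact exists_nat_gt x
  have hmono : Monotone (fun n : ℕ => S ∩ Iio (n : ℝ)) := by
    intro a b hab
    exact inter_subset_inter_right _ (Iio_subset_Iio (by exact_mod_cast hab))
  rw [hU, hmono.measure_iUnion] at h
  obtain ⟨n, hn⟩ := lt_iSup_iff.1 h
  have h0 : φ 0 = 0 := by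
    have : mu0 (S ∩ Iio 0) = 0 := by
      rw [mu0_apply_inter _ (hS.inter measurableSet_Iio)]
      have : S ∩ Iio 0 ∩ Ioi 0 = (∅ : Set ℝ) := by
        ext x; simp only [mem_inter_iff, mem_Iio, mem_Ioi, mem_empty_iff_false, iff_false]
        rintro ⟨⟨_, h1⟩, h2⟩; linarith
      rw [this]; simp
    simp [hφ, this]
  have hnc : c ≤ φ n := by
    rw [hφ]
    exact (ENNReal.ofReal_le_iff_le_toReal (mu0_Iio_lt_top _ _).ne).1 hn.le
  obtain ⟨r, _, hr⟩ := intermediate_value_Icc (Nat.cast_nonneg n) (hlip.continuous.continuousOn)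
    (show c ∈ Icc (φ 0) (φ n) from ⟨by rw [h0]; exact hc, hnc⟩)
  refine ⟨S ∩ Iio r, hS.inter measurableSet_Iio, inter_subset_left, ?_⟩
  rw [← hr, hφ, ENNReal.ofReal_toReal (mu0_Iio_lt_top _ _).ne]

lemma Ico4_disj (i j : ℤ) (hij : i ≠ j) :
    Disjoint (Ico ((4:ℝ) ^ i) (4 ^ (i + 1))) (Ico ((4:ℝ) ^ j) (4 ^ (j + 1))) := by
  rw [Set.disjoint_left]
  rintro x ⟨h1, h2⟩ ⟨h3, h4⟩
  have a1 : i < j + 1 := (zpow_lt_zpow_iff_right₀ (by norm_num : (1:ℝ) < 4)).1 (h1.trans_lt h4)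
  have a2 : j < i + 1 := (zpow_lt_zpow_iff_right₀ (by norm_num : (1:ℝ) < 4)).1 (h3.trans_lt h2)
  omega

lemma sum_lem (E : ℤ → Set ℝ) (hE : ∀ j, mu0 (E j) ≤ ENNReal.ofReal ((4:ℝ) ^ j / 2)) (Z : Set ℤ)
    (T : ℝ) (hT : ∀ j ∈ Z, (4:ℝ) ^ j ≤ T) :
    mu0 (⋃ j : Z, E j) ≤ ENNReal.ofReal (2 / 3 * T) := by
  calc mu0 (⋃ j : Z, E j) ≤ ∑' j : Z, mu0 (E j) := measure_iUnion_le _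
    _ ≤ ∑' j : Z, ENNReal.ofReal (2/3) * volume (Ico ((4:ℝ) ^ ((j:ℤ) - 1)) (4 ^ ((j:ℤ) - 1 + 1))) := by
        gcongr with j
        refine (hE j).trans ?_
        rw [Real.volume_Ico, ← ENNReal.ofReal_mul (by norm_num)]
        apply ENNReal.ofReal_le_ofReal
        rw [zpow_add₀ (by norm_num), zpow_sub₀ (by norm_num)]
        norm_num
        linarith
    _ = ENNReal.ofReal (2/3) * volume (⋃ j : Z, Ico ((4:ℝ) ^ ((j:ℤ) - 1)) (4 ^ ((j:ℤ) - 1 + 1))) := by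
        rw [ENNReal.tsum_mul_left, measure_iUnion]
        · intro i j hij
          exact Ico4_disj _ _ (by intro h; exact hij (Subtype.ext (by linarith)))
        · intro j; exact measurableSet_Ico
    _ ≤ ENNReal.ofReal (2/3) * volume (Ioo 0 T) := by
        gcongr
        apply iUnion_subset
        rintro ⟨j, hj⟩ x ⟨h1, h2⟩
        refine ⟨lt_of_lt_of_le (by positivity) h1, lt_of_lt_of_le h2 ?_⟩
        simpa using hT j hj
    _ = _ := by rw [Real.volume_Ioo, ← ENNReal.ofReal_mul (by norm_num), sub_zero]

lemma Ico4_union : (⋃ j : ℤ, Ico ((4:ℝ) ^ j) (4 ^ (j + 1))) = Ioi 0 := by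
  ext x
  simp only [mem_iUnion, mem_Ioi]
  constructor
  · rintro ⟨j, h1, _⟩
    exact lt_of_lt_of_le (by positivity) h1
  · intro hx
    exact exists_mem_Ico_zpow hx (by norm_num)

lemma dyadic (u V w : ℝ → ℝ≥0∞) (hu : AntitoneOn u (Ioi 0)) (hV : AntitoneOn V (Ioi 0))
    (hum : Measurable u) (hVm : Measurable V)
    (hyp : ∀ j : ℤ, ∀ θ < V (4 ^ j), ∃ E, MeasurableSet E ∧ mu0 E = ENNReal.ofReal ((4:ℝ) ^ j / 2) ∧
      ∀ x ∈ E, θ ≤ 2 * w x)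
    (B : ℝ≥0∞) (hB : ∀ v, Measurable v → (∀ t, 0 < t → rearr v t ≤ u t) →
      ∫⁻ x, v x * w x ∂mu0 ≤ B) :
    ∫⁻ x, u x * V x ∂mu0 ≤ 36 * B := by
  have main : ∀ l : ℕ, ∫⁻ x, u x * min (V x) l ∂mu0 ≤ 36 * B := by
    intro l
    have hex : ∀ j : ℤ, ∃ E, MeasurableSet E ∧ mu0 E ≤ ENNReal.ofReal ((4:ℝ) ^ j / 2) ∧
        (V (4 ^ j) = 0 ∨ (mu0 E = ENNReal.ofReal ((4:ℝ) ^ j / 2) ∧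
          ∀ x ∈ E, min (V (4 ^ j)) l ≤ 4 * w x)) := by
      intro j
      by_cases h0 : min (V (4 ^ j)) l = 0
      · by_cases hV0 : V (4 ^ j) = 0
        · exact ⟨∅, MeasurableSet.empty, by simp, Or.inl hV0⟩
        · obtain ⟨E, h1, h2, h3⟩ := hyp j 0 (pos_iff_ne_zero.2 hV0)
          exact ⟨E, h1, h2.le, Or.inr ⟨h2, by simp [h0]⟩⟩
      · have hlt : min (V (4 ^ j)) l / 2 < V (4 ^ j) := by
          refine lt_of_lt_of_le (ENNReal.half_lt_self h0 ?_) (min_le_left _ _)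
          exact ne_top_of_le_ne_top (ENNReal.natCast_ne_top l) (min_le_right _ _)
        obtain ⟨E, h1, h2, h3⟩ := hyp j _ hlt
        refine ⟨E, h1, h2.le, Or.inr ⟨h2, fun x hx => ?_⟩⟩
        have := (ENNReal.div_le_iff (by norm_num) (by norm_num)).1 (h3 x hx)
        refine this.trans (le_of_eq ?_)
        ring
    choose E hEm hEle hE using hex
    set A : ℤ → Set ℝ := fun j => E j \ ⋃ i : Iio j, E i with hA
    have hAm : ∀ j, MeasurableSet (A j) := fun j =>
      (hEm j).diff (MeasurableSet.iUnion fun i => hEm i)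
    have hAE : ∀ j, A j ⊆ E j := fun j => sdiff_subset
    have hAd : Pairwise (Function.onFun Disjoint A) := by
      have aux : ∀ i j, i < j → Disjoint (A i) (A j) := by
        intro i j hij
        rw [Set.disjoint_left]
        intro x hx hx2
        exact hx2.2 (mem_iUnion.2 ⟨⟨i, hij⟩, hAE i hx⟩)
      intro i j hij
      rcases lt_or_gt_of_ne hij with h | h
      · exact aux i j h
      · exact (aux j i h).symm
    have hAlow : ∀ j, mu0 (E j) = ENNReal.ofReal ((4:ℝ) ^ j / 2) →
        ENNReal.ofReal ((4:ℝ) ^ j / 3) ≤ mu0 (A j) := by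
      intro j hj
      have h1 := sum_lem E hEle (Iio j) (4 ^ (j - 1)) (fun i hi =>
        zpow_le_zpow_right₀ (by norm_num) (by have := mem_Iio.1 hi; omega))
      have h2 : mu0 (E j) ≤ mu0 (⋃ i : Iio j, E i) + mu0 (A j) := by
        refine (measure_mono ?_).trans (measure_union_le _ _)
        intro x hx
        by_cases h : x ∈ ⋃ i : Iio j, E i
        · exact Or.inl h
        · exact Or.inr ⟨hx, h⟩
      have h3 : ENNReal.ofReal ((4:ℝ) ^ j / 2) ≤ ENNReal.ofReal ((4:ℝ)^j / 6) + mu0 (A j) := by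
        rw [← hj]
        refine h2.trans ?_
        gcongr
        refine h1.trans (ENNReal.ofReal_le_ofReal ?_)
        rw [zpow_sub₀ (by norm_num)]
        norm_num
        linarith
      have h4 : ENNReal.ofReal ((4:ℝ) ^ j / 2) = ENNReal.ofReal ((4:ℝ)^j / 6) + ENNReal.ofReal ((4:ℝ)^j / 3) := by
        rw [← ENNReal.ofReal_add (by positivity) (by positivity)]
        congr 1; ring
      rw [h4] at h3
      exact (ENNReal.add_le_add_iff_left ENNReal.ofReal_ne_top).1 h3
    set v : ℝ → ℝ≥0∞ := fun x => ⨆ j : ℤ, (A j).indicator (fun _ => u (4 ^ j)) x with hv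
    have hvm : Measurable v := .iSup fun j => measurable_const.indicator (hAm j)
    have hvr : ∀ t, 0 < t → rearr v t ≤ u t := by
      intro t ht
      apply rearr_le
      have h1 := sum_lem E hEle {j | (4:ℝ) ^ j ≤ t} t (fun j hj => hj)
      refine (measure_mono ?_).trans (h1.trans (ENNReal.ofReal_le_ofReal (by linarith)))
      intro x hx
      obtain ⟨j, hj⟩ := lt_iSup_iff.1 (show u t < v x from hx)
      have hxA : x ∈ A j := by
        by_contra h
        rw [indicator_of_notMem h] at hj
        exact absurd hj (not_lt.2 zero_le)
      rw [indicator_of_mem hxA] at hj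
      refine mem_iUnion.2 ⟨⟨j, ?_⟩, hAE j hxA⟩
      by_contra h
      exact absurd (hu ht (show (4:ℝ)^j ∈ Ioi 0 from mem_Ioi.2 (by positivity)) (not_le.1 h).le) (not_le.2 hj)
    have hper : ∀ j : ℤ, ∫⁻ x in Ico ((4:ℝ) ^ j) (4 ^ (j + 1)), u x * min (V x) l ≤
        36 * ∫⁻ x in A j, v x * w x ∂mu0 := by
      intro j
      have h4 : (0:ℝ) < 4 ^ j := by positivity
      have h1 : ∫⁻ x in Ico ((4:ℝ) ^ j) (4 ^ (j + 1)), u x * min (V x) l ≤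
          u (4 ^ j) * min (V (4 ^ j)) l * ENNReal.ofReal (3 * 4 ^ j) := by
        calc _ ≤ ∫⁻ x in Ico ((4:ℝ) ^ j) (4 ^ (j + 1)), u (4 ^ j) * min (V (4 ^ j)) l := by
              apply setLIntegral_mono measurable_const
              intro x hx
              have hx0 : x ∈ Ioi (0:ℝ) := mem_Ioi.2 (h4.trans_le hx.1)
              have a1 := hu (mem_Ioi.2 h4) hx0 hx.1
              have a2 := hV (mem_Ioi.2 h4) hx0 hx.1
              gcongr
          _ = _ := by
              rw [setLIntegral_const, Real.volume_Ico, zpow_add₀ (by norm_num)]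
              congr 2
              norm_num
              ring
      refine h1.trans ?_
      rcases hE j with h0 | ⟨h0, hw⟩
      · simp [h0]
      · calc u (4 ^ j) * min (V (4 ^ j)) l * ENNReal.ofReal (3 * 4 ^ j)
            ≤ u (4 ^ j) * min (V (4 ^ j)) l * (9 * mu0 (A j)) := by
              gcongr
              calc ENNReal.ofReal (3 * 4 ^ j) = 9 * ENNReal.ofReal ((4:ℝ) ^ j / 3) := by
                    rw [show (9:ℝ≥0∞) = ENNReal.ofReal 9 by simp, ← ENNReal.ofReal_mul (by norm_num)]
                    congr 1; ring
                _ ≤ _ := by gcongr; exact hAlow j h0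
          _ = 9 * ∫⁻ x in A j, u (4 ^ j) * min (V (4 ^ j)) l ∂mu0 := by
              rw [setLIntegral_const]; ring
          _ ≤ 9 * ∫⁻ x in A j, 4 * (v x * w x) ∂mu0 := by
              gcongr 9 * ?_
              apply lintegral_mono_ae
              filter_upwards [ae_restrict_mem (hAm j)] with x hx
              have a1 : u (4 ^ j) ≤ v x := by
                refine le_iSup_of_le j ?_
                rw [indicator_of_mem hx]
              calc _ ≤ v x * (4 * w x) := by
                    gcongr; exact hw x (hAE j hx)
                _ = _ := by ring
          _ = _ := by
              rw [lintegral_const_mul' _ _ (by norm_num), ← mul_assoc]; norm_num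
    calc ∫⁻ x, u x * min (V x) l ∂mu0
        = ∑' j : ℤ, ∫⁻ x in Ico ((4:ℝ) ^ j) (4 ^ (j + 1)), u x * min (V x) l := by
          rw [mu0, ← Ico4_union, lintegral_iUnion (fun j => measurableSet_Ico)
            (fun i j hij => Ico4_disj i j hij)]
      _ ≤ ∑' j : ℤ, 36 * ∫⁻ x in A j, v x * w x ∂mu0 := by
          gcongr with j; exact hper j
      _ = 36 * ∫⁻ x in ⋃ j, A j, v x * w x ∂mu0 := by
          rw [ENNReal.tsum_mul_left, lintegral_iUnion hAm hAd]
      _ ≤ 36 * ∫⁻ x, v x * w x ∂mu0 := by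
          gcongr; exact Measure.restrict_le_self
      _ ≤ _ := by gcongr; exact hB v hvm hvr
  calc ∫⁻ x, u x * V x ∂mu0 = ∫⁻ x, ⨆ l : ℕ, u x * min (V x) l ∂mu0 := by
        congr 1; funext x
        rw [← ENNReal.mul_iSup, iSup_min_nat]
    _ = ⨆ l : ℕ, ∫⁻ x, u x * min (V x) l ∂mu0 := by
        apply lintegral_iSup
        · intro l; exact hum.mul (hVm.min measurable_const)
        · intro a b hab t
          dsimp only
          gcongr
    _ ≤ _ := iSup_le main

lemma test_rearr {ρ : (ℝ → ℝ≥0∞) → ℝ≥0∞} (hY : IsRINorm ρ) (f u : ℝ → ℝ≥0∞) (hf : Measurable f)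
    (hu : Measurable u) (hua : AntitoneOn u (Ioi 0)) (hfin : ρ u ≠ ∞) :
    ∫⁻ x, u x * rearr f x ∂mu0 ≤ 36 * (ρ u * associate ρ f) := by
  apply dyadic u (rearr f) f hua ((rearr_antitone f).antitoneOn _) hu (rearr_meas f)
  · intro j θ hθ
    rw [lt_rearr_iff] at hθ
    have hlt : ENNReal.ofReal ((4:ℝ) ^ j / 2) < mu0 {x | θ < f x} := by
      refine lt_of_le_of_lt (ENNReal.ofReal_le_ofReal ?_) hθ
      have : (0:ℝ) < 4 ^ j := by positivity
      linarith
    obtain ⟨E, h1, h2, h3⟩ := exists_subset_mu0 _ (measurableSet_lt measurable_const hf) _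
      (by positivity) hlt
    refine ⟨E, h1, h3, fun x hx => (le_of_lt (h2 hx)).trans ?_⟩
    calc f x = 1 * f x := (one_mul _).symm
      _ ≤ 2 * f x := by gcongr; norm_num
  · intro v hv hvr
    have h1 := rho_le_of_rearr_le hY v u hv hu hvr
    exact (holder hY v f hv (ne_top_of_le_ne_top hfin h1)).trans (by gcongr)


def Hop (α : ℝ) (f : ℝ → ℝ≥0∞) (t : ℝ) : ℝ≥0∞ :=
  ∫⁻ s in Set.Ioi t, f s * ENNReal.ofReal (s ^ (α - 1))

def Fi (f : ℝ → ℝ≥0∞) (s : ℝ) : ℝ≥0∞ := ∫⁻ x in Ioo 0 s, rearr f x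

def Mx (α : ℝ) (f : ℝ → ℝ≥0∞) (t : ℝ) : ℝ≥0∞ :=
  ⨆ (s : ℝ) (_ : t ≤ s), ENNReal.ofReal (s ^ α) * rearr f s

def Nf (α : ℝ) (f : ℝ → ℝ≥0∞) (s : ℝ) : ℝ≥0∞ :=
  ⨆ (t : ℝ) (_ : s ≤ t), ENNReal.ofReal (t ^ (α - 1)) * Fi f t

lemma Hop_antitone (α : ℝ) (f : ℝ → ℝ≥0∞) : Antitone (Hop α f) := by
  intro a b hab
  exact lintegral_mono_set (Ioi_subset_Ioi hab)

lemma Mx_antitone (α : ℝ) (f : ℝ → ℝ≥0∞) : Antitone (Mx α f) := by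
  intro a b hab
  exact iSup_le fun s => iSup_le fun hs => le_iSup_of_le s (le_iSup_of_le (hab.trans hs) le_rfl)

lemma Nf_antitone (α : ℝ) (f : ℝ → ℝ≥0∞) : Antitone (Nf α f) := by
  intro a b hab
  exact iSup_le fun s => iSup_le fun hs => le_iSup_of_le s (le_iSup_of_le (hab.trans hs) le_rfl)

lemma Fi_mono (f : ℝ → ℝ≥0∞) : Monotone (Fi f) := by
  intro a b hab
  exact lintegral_mono_set (Ioo_subset_Ioo_right hab)

lemma le_Nf (α : ℝ) (f : ℝ → ℝ≥0∞) (s t : ℝ) (h : s ≤ t) :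
    ENNReal.ofReal (t ^ (α - 1)) * Fi f t ≤ Nf α f s := le_iSup_of_le t (le_iSup_of_le h le_rfl)

lemma le_Mx (α : ℝ) (f : ℝ → ℝ≥0∞) (s t : ℝ) (h : s ≤ t) :
    ENNReal.ofReal (t ^ α) * rearr f t ≤ Mx α f s := le_iSup_of_le t (le_iSup_of_le h le_rfl)

lemma supOp_eq (α : ℝ) (f : ℝ → ℝ≥0∞) (t : ℝ) :
    supOp α f t = ENNReal.ofReal (t ^ (-α)) * Mx α f t := rfl

lemma supOp_meas (α : ℝ) (f : ℝ → ℝ≥0∞) : Measurable (supOp α f) :=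
  Measurable.mul (by fun_prop) (Mx_antitone α f).measurable

lemma rpow_mul_ofReal (x a b : ℝ) (hx : 0 < x) :
    ENNReal.ofReal (x ^ a) * ENNReal.ofReal (x ^ b) = ENNReal.ofReal (x ^ (a + b)) := by
  rw [← ENNReal.ofReal_mul (by positivity), Real.rpow_add hx]

lemma rearr_le_supOp (α : ℝ) (f : ℝ → ℝ≥0∞) (t : ℝ) (ht : 0 < t) : rearr f t ≤ supOp α f t := by
  calc rearr f t = ENNReal.ofReal (t ^ (-α)) * (ENNReal.ofReal (t ^ α) * rearr f t) := by
        rw [← mul_assoc, rpow_mul_ofReal _ _ _ ht]; simp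
    _ ≤ _ := by rw [supOp_eq]; gcongr; exact le_Mx _ _ _ _ le_rfl

lemma supOp_antitone (α : ℝ) (hα : 0 < α) (f : ℝ → ℝ≥0∞) : AntitoneOn (supOp α f) (Ioi 0) := by
  intro a ha b hb hab
  rw [supOp_eq, supOp_eq]
  have h1 : b ^ (-α) ≤ a ^ (-α) := Real.rpow_le_rpow_of_nonpos ha hab (by linarith)
  have h2 := Mx_antitone α f hab
  gcongr

lemma rint (p a : ℝ) (hp : 0 < p) (ha : 0 ≤ a) :
    ∫⁻ x in Ioo 0 a, ENNReal.ofReal (x ^ (p - 1)) = ENNReal.ofReal (a ^ p / p) := by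
  have hi : IntervalIntegrable (fun x : ℝ => x ^ (p - 1)) volume 0 a :=
    intervalIntegral.intervalIntegrable_rpow' (by linarith)
  rw [intervalIntegrable_iff_integrableOn_Ioo_of_le ha] at hi
  rw [← ofReal_integral_eq_lintegral_ofReal hi]
  · rw [← integral_Ioc_eq_integral_Ioo, ← intervalIntegral.integral_of_le ha,
      integral_rpow (Or.inl (by linarith))]
    congr 1
    simp [Real.zero_rpow hp.ne']
  · filter_upwards [ae_restrict_mem measurableSet_Ioo] with x hx
    exact Real.rpow_nonneg hx.1.le _

lemma tonelli (D : Set (ℝ × ℝ)) (hD : MeasurableSet D) (p G : ℝ → ℝ≥0∞) (hp : Measurable p)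
    (hG : Measurable G) :
    ∫⁻ r, p r * ∫⁻ u in {u | (r, u) ∈ D}, G u = ∫⁻ u, G u * ∫⁻ r in {r | (r, u) ∈ D}, p r := by
  have hm1 : ∀ r, MeasurableSet {u | (r, u) ∈ D} := fun r => measurable_prodMk_left hD
  have hm2 : ∀ u, MeasurableSet {r | (r, u) ∈ D} := fun u => measurable_prodMk_right hD
  calc ∫⁻ r, p r * ∫⁻ u in {u | (r, u) ∈ D}, G u
      = ∫⁻ r, ∫⁻ u, D.indicator (fun q => p q.1 * G q.2) (r, u) := by
        congr 1; funext r
        rw [← lintegral_indicator (hm1 r), ← lintegral_const_mul _ (hG.indicator (hm1 r))]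
        congr 1; funext u
        by_cases h : (r, u) ∈ D <;> simp [indicator, h]
    _ = ∫⁻ u, ∫⁻ r, D.indicator (fun q => p q.1 * G q.2) (r, u) := by
        rw [lintegral_lintegral_swap]
        exact (Measurable.indicator (f := fun q : ℝ × ℝ => p q.1 * G q.2) (by fun_prop) hD).aemeasurable
    _ = _ := by
        congr 1; funext u
        rw [← lintegral_indicator (hm2 u), ← lintegral_const_mul _ (hp.indicator (hm2 u))]
        congr 1; funext r
        by_cases h : (r, u) ∈ D <;> simp [indicator, h, mul_comm]

lemma fub (α : ℝ) (g h : ℝ → ℝ≥0∞) (hg : Measurable g) (hh : Measurable h) :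
    ∫⁻ t, g t * Hop α h t ∂mu0 =
      ∫⁻ s, h s * (ENNReal.ofReal (s ^ (α - 1)) * ∫⁻ x in Ioo 0 s, g x) ∂mu0 := by
  have hD : MeasurableSet {q : ℝ × ℝ | 0 < q.1 ∧ q.1 < q.2} :=
    (measurableSet_lt measurable_const measurable_fst).inter
      (measurableSet_lt measurable_fst measurable_snd)
  have hG : Measurable (fun s : ℝ => h s * ENNReal.ofReal (s ^ (α - 1))) := by fun_prop
  have := tonelli _ hD g _ hg hG
  rw [mu0, ← lintegral_indicator measurableSet_Ioi, ← lintegral_indicator measurableSet_Ioi]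
  refine Eq.trans (lintegral_congr fun t => ?_) (this.trans (lintegral_congr fun s => ?_))
  · by_cases ht : 0 < t
    · simp [ht, Hop, Ioi_def]
    · simp [ht]
  · symm
    by_cases hs : 0 < s
    · simp only [mem_Ioi, hs, indicator_of_mem, mem_ofPred_eq]
      rw [mul_assoc]; rfl
    · have : {r : ℝ | 0 < r ∧ r < s} = ∅ := by
        ext r; simp only [mem_ofPred_eq, mem_empty_iff_false, iff_false]
        rintro ⟨h1, h2⟩; exact hs (h1.trans h2)
      simp [hs, this]

lemma Nf_bound (α : ℝ) (h0 : 0 < α) (h1 : α < 1) (f : ℝ → ℝ≥0∞) (s : ℝ) (hs : 0 < s) :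
    Nf α f s ≤ 2 * (ENNReal.ofReal (s ^ (α - 1)) * ∫⁻ r in Ioo 0 s, supOp α f r) := by
  set R := ENNReal.ofReal (s ^ (α - 1)) * ∫⁻ r in Ioo 0 s, supOp α f r with hR
  have hq : (0:ℝ) < 1 - α := by linarith
  have e1 : ENNReal.ofReal (s ^ (α - 1)) * Fi f s ≤ R := by
    rw [hR]; refine mul_le_mul' le_rfl ?_
    apply setLIntegral_mono (supOp_meas α f)
    intro x hx; exact rearr_le_supOp _ _ _ hx.1
  have cancel : ∀ t : ℝ, 0 < t → ENNReal.ofReal (t ^ (α - 1)) * ENNReal.ofReal (t ^ (1 - α) / (1 - α))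
      = ENNReal.ofReal (1 / (1 - α)) := by
    intro t ht
    rw [← ENNReal.ofReal_mul (by positivity), ← mul_div_assoc, ← Real.rpow_add ht]
    simp
  have rint' : ∀ t : ℝ, 0 < t → ∫⁻ r in Ioo 0 t, ENNReal.ofReal (r ^ (-α)) =
      ENNReal.ofReal (t ^ (1 - α) / (1 - α)) := by
    intro t ht
    rw [← rint (1 - α) t hq ht.le]
    congr 1; funext r; congr 2; ring
  have hmr : Measurable (fun r : ℝ => ENNReal.ofReal (r ^ (-α))) := by fun_prop
  have e2 : ENNReal.ofReal (1 / (1 - α)) * Mx α f s ≤ R := by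
    calc _ = ENNReal.ofReal (s ^ (α - 1)) * ∫⁻ r in Ioo 0 s, ENNReal.ofReal (r ^ (-α)) * Mx α f s := by
          rw [lintegral_mul_const _ hmr, rint' s hs, ← mul_assoc, cancel s hs]
      _ ≤ R := by
          rw [hR]; refine mul_le_mul' le_rfl ?_
          apply setLIntegral_mono (supOp_meas α f)
          intro x hx
          rw [supOp_eq]; gcongr
          exact Mx_antitone _ _ hx.2.le
  refine iSup_le fun t => iSup_le fun hst => ?_
  have ht : 0 < t := hs.trans_le hst
  have e3 : Fi f t ≤ Fi f s + ENNReal.ofReal (t ^ (1 - α) / (1 - α)) * Mx α f s := by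
    have hsub : Ioo 0 t ⊆ Ioo 0 s ∪ Ico s t := by
      intro x hx
      by_cases h : x < s
      · exact Or.inl ⟨hx.1, h⟩
      · exact Or.inr ⟨not_lt.1 h, hx.2⟩
    calc Fi f t ≤ ∫⁻ x in Ioo 0 s ∪ Ico s t, rearr f x := lintegral_mono_set hsub
      _ ≤ Fi f s + ∫⁻ x in Ico s t, rearr f x := lintegral_union_le _ _ _
      _ ≤ _ := by
        gcongr
        calc ∫⁻ x in Ico s t, rearr f x ≤ ∫⁻ x in Ico s t, ENNReal.ofReal (x ^ (-α)) * Mx α f s := by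
              apply setLIntegral_mono (hmr.mul_const _)
              intro x hx
              have hx0 : 0 < x := hs.trans_le hx.1
              refine (rearr_le_supOp α f x hx0).trans ?_
              rw [supOp_eq]; gcongr; exact Mx_antitone _ _ hx.1
          _ ≤ ∫⁻ x in Ioo 0 t, ENNReal.ofReal (x ^ (-α)) * Mx α f s := by
              apply lintegral_mono_set
              intro x hx; exact ⟨hs.trans_le hx.1, hx.2⟩
          _ = _ := by rw [lintegral_mul_const _ hmr, rint' t ht]
  calc ENNReal.ofReal (t ^ (α - 1)) * Fi f t
      ≤ ENNReal.ofReal (t ^ (α - 1)) * (Fi f s + ENNReal.ofReal (t ^ (1 - α) / (1 - α)) * Mx α f s) := by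
        gcongr
    _ = ENNReal.ofReal (t ^ (α - 1)) * Fi f s + ENNReal.ofReal (1 / (1 - α)) * Mx α f s := by
        rw [mul_add, ← mul_assoc, cancel t ht]
    _ ≤ R + R := by
        gcongr
        refine le_trans ?_ e1
        gcongr ENNReal.ofReal ?_ * _
        exact Real.rpow_le_rpow_of_nonpos hs hst (by linarith)
    _ = 2 * R := (two_mul R).symm

lemma Mx_le_Nf (α : ℝ) (f : ℝ → ℝ≥0∞) (a : ℝ) (ha : 0 < a) : Mx α f a ≤ Nf α f a := by
  refine iSup_le fun t => iSup_le fun hat => ?_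
  have ht : 0 < t := ha.trans_le hat
  refine le_trans ?_ (le_Nf α f a t hat)
  calc ENNReal.ofReal (t ^ α) * rearr f t
      = ENNReal.ofReal (t ^ (α - 1)) * ∫⁻ x in Ioo 0 t, rearr f t := by
        rw [setLIntegral_const, Real.volume_Ioo, sub_zero, mul_comm (rearr f t), ← mul_assoc]
        congr 1
        rw [← ENNReal.ofReal_mul (by positivity)]
        congr 1
        rw [Real.rpow_sub_one ht.ne']; field_simp
    _ ≤ _ := by
        refine mul_le_mul' le_rfl ?_
        apply setLIntegral_mono (rearr_meas f)
        intro x hx; exact rearr_antitone f hx.2.le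

lemma supOp_int (α : ℝ) (h0 : 0 < α) (h1 : α < 1) (f : ℝ → ℝ≥0∞) (a : ℝ) (ha : 0 < a) :
    ∫⁻ r in Ioo 0 a, supOp α f r ≤
      ENNReal.ofReal (5 / (1 - α)) * (ENNReal.ofReal (a ^ (1 - α)) * Nf α f a) := by
  have hq : (0:ℝ) < 1 - α := by linarith
  have hmr : Measurable (fun r : ℝ => ENNReal.ofReal (r ^ (-α))) := by fun_prop
  have rint' : ∀ t : ℝ, 0 < t → ∫⁻ r in Ioo 0 t, ENNReal.ofReal (r ^ (-α)) =
      ENNReal.ofReal (t ^ (1 - α) / (1 - α)) := by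
    intro t ht
    rw [← rint (1 - α) t hq ht.le]
    congr 1; funext r; congr 2; ring
  set G : ℝ → ℝ≥0∞ := fun u => ENNReal.ofReal (u ^ (α - 1)) * rearr f u with hG
  have hGm : Measurable G := Measurable.mul (by fun_prop) (rearr_meas f)
  have pw : ∀ r ∈ Ioo 0 a, supOp α f r ≤
      2 * (ENNReal.ofReal (r ^ (-α)) * ∫⁻ u in Ioo (r / 2) a, G u) +
        ENNReal.ofReal (r ^ (-α)) * Nf α f a := by
    intro r hr
    rw [supOp_eq]
    have : Mx α f r ≤ 2 * (∫⁻ u in Ioo (r / 2) a, G u) + Nf α f a := by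
      refine iSup_le fun s => iSup_le fun hrs => ?_
      by_cases hsa : a ≤ s
      · exact ((le_Mx α f a s hsa).trans (Mx_le_Nf α f a ha)).trans le_add_self
      · have hsa := not_le.1 hsa
        have hs : 0 < s := hr.1.trans_le hrs
        refine le_trans ?_ le_self_add
        calc ENNReal.ofReal (s ^ α) * rearr f s
            = 2 * ∫⁻ u in Ioo (s / 2) s, ENNReal.ofReal (s ^ (α - 1)) * rearr f s := by
              rw [setLIntegral_const, Real.volume_Ioo,
                show ∀ x y z : ℝ≥0∞, 2 * (x * y * z) = (x * (2 * z)) * y by intros; ring]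
              congr 1
              rw [show (2:ℝ≥0∞) = ENNReal.ofReal 2 by simp, ← ENNReal.ofReal_mul (by norm_num),
                ← ENNReal.ofReal_mul (by positivity)]
              congr 1
              rw [Real.rpow_sub_one hs.ne']; field_simp; ring
          _ ≤ 2 * ∫⁻ u in Ioo (s / 2) s, G u := by
              gcongr 2 * ?_
              apply setLIntegral_mono hGm
              intro u hu
              have hu0 : 0 < u := lt_trans (by linarith) hu.1
              have a1 : s ^ (α - 1) ≤ u ^ (α - 1) :=
                Real.rpow_le_rpow_of_nonpos hu0 hu.2.le (by linarith)
              have a2 := rearr_antitone f hu.2.le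
              simp only [hG]
              gcongr
          _ ≤ _ := by
              gcongr 2 * ?_
              apply lintegral_mono_set
              apply Ioo_subset_Ioo <;> linarith
    calc _ ≤ ENNReal.ofReal (r ^ (-α)) * (2 * (∫⁻ u in Ioo (r / 2) a, G u) + Nf α f a) := by gcongr
      _ = _ := by ring
  have hin : Measurable (fun r : ℝ => ∫⁻ u in Ioo (r / 2) a, G u) := by
    apply Antitone.measurable
    intro x y hxy
    exact lintegral_mono_set (Ioo_subset_Ioo_left (by linarith))
  have hfirst : ∫⁻ r in Ioo 0 a, ENNReal.ofReal (r ^ (-α)) * ∫⁻ u in Ioo (r / 2) a, G u ≤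
      ENNReal.ofReal (2 / (1 - α)) * Fi f a := by
    have hD : MeasurableSet {q : ℝ × ℝ | (0 < q.1 ∧ q.1 < a) ∧ (q.1 / 2 < q.2 ∧ q.2 < a)} := by
      refine MeasurableSet.inter (MeasurableSet.inter ?_ ?_) (MeasurableSet.inter ?_ ?_)
      · exact measurableSet_lt measurable_const measurable_fst
      · exact measurableSet_lt measurable_fst measurable_const
      · exact measurableSet_lt (measurable_fst.div_const _) measurable_snd
      · exact measurableSet_lt measurable_snd measurable_const
    have := tonelli _ hD _ G hmr hGm
    calc ∫⁻ r in Ioo 0 a, ENNReal.ofReal (r ^ (-α)) * ∫⁻ u in Ioo (r / 2) a, G u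
        = ∫⁻ r, ENNReal.ofReal (r ^ (-α)) * ∫⁻ u in {u | (r, u) ∈ {q : ℝ × ℝ | (0 < q.1 ∧ q.1 < a) ∧ (q.1 / 2 < q.2 ∧ q.2 < a)}}, G u := by
          rw [← lintegral_indicator measurableSet_Ioo]
          congr 1; funext r
          by_cases hr : r ∈ Ioo 0 a
          · rw [indicator_of_mem hr]
            congr 3
            ext u
            simp only [mem_ofPred_eq, mem_Ioo]
            exact ⟨fun h => ⟨hr, h⟩, fun h => h.2⟩
          · rw [indicator_of_notMem hr]
            have : {u | (r, u) ∈ {q : ℝ × ℝ | (0 < q.1 ∧ q.1 < a) ∧ (q.1 / 2 < q.2 ∧ q.2 < a)}} = ∅ := by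
              ext u
              simp only [mem_ofPred_eq, mem_empty_iff_false, iff_false]
              exact fun h => hr h.1
            rw [this]; simp
      _ = _ := this
      _ ≤ ∫⁻ u, (Ioo 0 a).indicator (fun u => ENNReal.ofReal (2 / (1 - α)) * rearr f u) u := by
          apply lintegral_mono
          intro u
          dsimp only
          by_cases hu : u ∈ Ioo 0 a
          · rw [indicator_of_mem hu]
            have hu0 : 0 < u := hu.1
            calc _ ≤ G u * ∫⁻ r in Ioo 0 (2 * u), ENNReal.ofReal (r ^ (-α)) := by
                  refine mul_le_mul' le_rfl ?_
                  apply lintegral_mono_set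
                  rintro r ⟨⟨a1, a2⟩, a3, a4⟩
                  exact ⟨a1, by simp only at a3; linarith⟩
              _ = ENNReal.ofReal (u ^ (α - 1) * ((2 * u) ^ (1 - α) / (1 - α))) * rearr f u := by
                  rw [rint' _ (by linarith), ENNReal.ofReal_mul (by positivity)]
                  simp only [hG]; ring
              _ ≤ _ := by
                  gcongr
                  rw [Real.mul_rpow (by norm_num) hu0.le]
                  have b1 : u ^ (α - 1) * u ^ (1 - α) = 1 := by
                    rw [← Real.rpow_add hu0]; simp
                  have b2 : (2:ℝ) ^ (1 - α) ≤ 2 := by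
                    calc (2:ℝ) ^ (1 - α) ≤ 2 ^ (1:ℝ) :=
                          Real.rpow_le_rpow_of_exponent_le (by norm_num) (by linarith)
                      _ = 2 := by simp
                  calc u ^ (α - 1) * (2 ^ (1 - α) * u ^ (1 - α) / (1 - α))
                      = (u ^ (α - 1) * u ^ (1 - α)) * 2 ^ (1 - α) / (1 - α) := by ring
                    _ ≤ 2 / (1 - α) := by rw [b1, one_mul]; gcongr
          · rw [indicator_of_notMem hu]
            have : {r | (r, u) ∈ {q : ℝ × ℝ | (0 < q.1 ∧ q.1 < a) ∧ (q.1 / 2 < q.2 ∧ q.2 < a)}} = ∅ := by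
              ext r
              simp only [mem_ofPred_eq, mem_empty_iff_false, iff_false]
              rintro ⟨⟨a1, a2⟩, a3, a4⟩
              exact hu ⟨by linarith, a4⟩
            rw [this]; simp
      _ = _ := by
          rw [lintegral_indicator measurableSet_Ioo, lintegral_const_mul _ (rearr_meas f)]; rfl
  have hFN : Fi f a ≤ ENNReal.ofReal (a ^ (1 - α)) * Nf α f a := by
    calc Fi f a = ENNReal.ofReal (a ^ (1 - α)) * (ENNReal.ofReal (a ^ (α - 1)) * Fi f a) := by
          rw [← mul_assoc, rpow_mul_ofReal _ _ _ ha]; simp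
      _ ≤ _ := by gcongr; exact le_Nf _ _ _ _ le_rfl
  calc ∫⁻ r in Ioo 0 a, supOp α f r
      ≤ ∫⁻ r in Ioo 0 a, (2 * (ENNReal.ofReal (r ^ (-α)) * ∫⁻ u in Ioo (r / 2) a, G u) +
        ENNReal.ofReal (r ^ (-α)) * Nf α f a) :=
        setLIntegral_mono (((hmr.mul hin).const_mul _).add (hmr.mul_const _)) pw
    _ = 2 * (∫⁻ r in Ioo 0 a, (ENNReal.ofReal (r ^ (-α)) * ∫⁻ u in Ioo (r / 2) a, G u)) +
        ENNReal.ofReal (a ^ (1 - α) / (1 - α)) * Nf α f a := by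
        rw [lintegral_add_right _ (hmr.mul_const _), lintegral_const_mul' _ _ (by norm_num),
          lintegral_mul_const _ hmr, rint' a ha]
    _ ≤ 2 * (ENNReal.ofReal (2 / (1 - α)) * (ENNReal.ofReal (a ^ (1 - α)) * Nf α f a)) +
        ENNReal.ofReal (1 / (1 - α)) * (ENNReal.ofReal (a ^ (1 - α)) * Nf α f a) := by
        gcongr ?_ + ?_
        · gcongr 2 * ?_
          exact hfirst.trans (by gcongr)
        · rw [← mul_assoc, ← ENNReal.ofReal_mul (by positivity)]
          apply le_of_eq; congr 2; ring
    _ = _ := by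
        rw [← mul_assoc, ← add_mul, show (2:ℝ≥0∞) = ENNReal.ofReal 2 by simp,
          ← ENNReal.ofReal_mul (by norm_num), ← ENNReal.ofReal_add (by positivity) (by positivity)]
        congr 2; ring


lemma Hop_rearr_bound (α : ℝ) (h0 : 0 < α) (h1 : α < 1) (ρ : (ℝ → ℝ≥0∞) → ℝ≥0∞) (hY : IsRINorm ρ)
    (K : ℝ≥0∞)
    (hK : ∀ f : ℝ → ℝ≥0∞, Measurable f → associate ρ (supOp α f) ≤ K * associate ρ f)
    (h : ℝ → ℝ≥0∞) (hh : Measurable h) :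
    ρ (Hop α h) ≤ (2 * K + 1) * ρ (Hop α (rearr h)) := by
  by_cases hfin : ρ (Hop α (rearr h)) = ∞
  · rw [hfin, ENNReal.mul_top (by simp)]; exact le_top
  refine le_trans ?_ (mul_le_mul' (le_self_add : 2 * K ≤ 2 * K + 1) le_rfl)
  refine lorentz_luxemburg hY _ (Hop_antitone α h).measurable _ ?_
  intro g hg hg1
  calc ∫⁻ t, Hop α h t * g t ∂mu0 = ∫⁻ t, g t * Hop α h t ∂mu0 := by simp_rw [mul_comm]
    _ = ∫⁻ s, h s * (ENNReal.ofReal (s ^ (α - 1)) * ∫⁻ x in Ioo 0 s, g x) ∂mu0 := fub α g h hg hh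
    _ ≤ ∫⁻ s, h s * Nf α g s ∂mu0 := by
        refine lintegral_mono fun s => mul_le_mul' le_rfl ?_
        exact (mul_le_mul' le_rfl (setInt_le_rearr g hg s)).trans (le_Nf α g s s le_rfl)
    _ ≤ ∫⁻ s, rearr h s * Nf α g s ∂mu0 :=
        HL h _ hh (Nf_antitone α g).measurable ((Nf_antitone α g).antitoneOn _)
    _ ≤ ∫⁻ s, 2 * (rearr h s * (ENNReal.ofReal (s ^ (α - 1)) * ∫⁻ r in Ioo 0 s, supOp α g r)) ∂mu0 := by
        refine lintegral_mono_ae ?_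
        filter_upwards [ae_pos] with s hs
        refine (mul_le_mul' le_rfl (Nf_bound α h0 h1 g s hs)).trans (le_of_eq ?_)
        ring
    _ = 2 * ∫⁻ t, supOp α g t * Hop α (rearr h) t ∂mu0 := by
        rw [lintegral_const_mul' _ _ (by norm_num), fub α _ _ (supOp_meas α g) (rearr_meas h)]
    _ = 2 * ∫⁻ t, Hop α (rearr h) t * supOp α g t ∂mu0 := by simp_rw [mul_comm]
    _ ≤ 2 * (ρ (Hop α (rearr h)) * associate ρ (supOp α g)) :=
        mul_le_mul' le_rfl (holder hY _ _ (Hop_antitone α _).measurable hfin)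
    _ ≤ 2 * (ρ (Hop α (rearr h)) * (K * 1)) := by
        refine mul_le_mul' le_rfl (mul_le_mul' le_rfl ((hK g hg).trans (mul_le_mul' le_rfl hg1)))
    _ = 2 * K * ρ (Hop α (rearr h)) := by ring

lemma phi_bound (α : ℝ) (h0 : 0 < α) (h1 : α < 1) (ρ : (ℝ → ℝ≥0∞) → ℝ≥0∞) (hY : IsRINorm ρ)
    (C : ℝ≥0∞) (hC : ∀ h : ℝ → ℝ≥0∞, Measurable h → ρ (Hop α h) ≤ C * ρ (Hop α (rearr h)))
    (t : ℝ) (ht : 1 ≤ t) :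
    ρ ((Ioo (0:ℝ) t).indicator 1) ≤
      ENNReal.ofReal (t ^ (1 - α)) * (2 * C * (ENNReal.ofReal (1 / α) * ρ ((Ioo (0:ℝ) 1).indicator 1))) := by
  have ht0 : 0 < t := by linarith
  set h : ℝ → ℝ≥0∞ := (Ioo t (t + 1)).indicator 1 with hh
  have hhm : Measurable h := measurable_one.indicator measurableSet_Ioo
  have hi1 : ∀ a : ℝ, Measurable ((Ioo (0:ℝ) a).indicator (1 : ℝ → ℝ≥0∞)) :=
    fun a => measurable_one.indicator measurableSet_Ioo
  have hr1 : ∀ s, rearr h s ≤ (Iio (1:ℝ)).indicator 1 s := by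
    intro s
    by_cases hs : s < 1
    · simp only [mem_Iio, hs, indicator_of_mem, Pi.one_apply]
      refine sInf_le ?_
      have : {x | (1:ℝ≥0∞) < h x} = ∅ := by
        ext x; simp only [mem_ofPred_eq, mem_empty_iff_false, iff_false, not_lt]
        exact indicator_le_self' (by simp) x |>.trans (by simp)
      simp only [mem_ofPred_eq]
      rw [this]; simp
    · have : rearr h s ≤ 0 := by
        refine sInf_le ?_
        simp only [mem_ofPred_eq]
        calc mu0 {x | 0 < h x} ≤ volume {x | 0 < h x} := Measure.restrict_apply_le _ _
          _ ≤ volume (Ioo t (t+1)) := by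
              apply measure_mono
              intro x hx
              by_contra hx'
              simp only [mem_ofPred_eq, hh, indicator_of_notMem hx'] at hx
              exact lt_irrefl _ hx
          _ = ENNReal.ofReal 1 := by simp
          _ ≤ _ := ENNReal.ofReal_le_ofReal (not_lt.1 hs)
      exact this.trans zero_le
  have hH : ∀ s, 0 < s → Hop α (rearr h) s ≤ ENNReal.ofReal (1 / α) * (Ioo (0:ℝ) 1).indicator 1 s := by
    intro s hs
    have e1 : Hop α (rearr h) s ≤ ∫⁻ r in Ioo s 1, ENNReal.ofReal (r ^ (α - 1)) := by
      calc Hop α (rearr h) s ≤ ∫⁻ r in Ioi s, (Iio (1:ℝ)).indicator (fun r => ENNReal.ofReal (r ^ (α - 1))) r := by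
            refine lintegral_mono fun r => ?_
            refine (mul_le_mul' (hr1 r) le_rfl).trans (le_of_eq ?_)
            by_cases hr : r ∈ Iio (1:ℝ) <;> simp [indicator, hr]
        _ = _ := by
            rw [lintegral_indicator measurableSet_Iio, Measure.restrict_restrict measurableSet_Iio,
              inter_comm, Ioi_inter_Iio]
    refine e1.trans ?_
    by_cases hs1 : s < 1
    · rw [indicator_of_mem (show s ∈ Ioo (0:ℝ) 1 from ⟨hs, hs1⟩)]
      calc _ ≤ ∫⁻ r in Ioo 0 1, ENNReal.ofReal (r ^ (α - 1)) :=
            lintegral_mono_set (Ioo_subset_Ioo_left hs.le)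
        _ = _ := by rw [rint α 1 h0 zero_le_one]; simp
    · rw [Ioo_eq_empty (by linarith)]; simp
  have hρ : ρ (Hop α (rearr h)) ≤ ENNReal.ofReal (1 / α) * ρ ((Ioo (0:ℝ) 1).indicator 1) := by
    have := hY.smul (1 / α).toNNReal _ (hi1 1)
    refine le_trans ?_ (le_of_eq this)
    refine hY.mono _ _ (Hop_antitone α _).measurable ((hi1 1).const_mul _) ?_
    filter_upwards [ae_pos] with s hs
    exact hH s hs
  have hlow : ∀ s ∈ Ioo 0 t, ENNReal.ofReal (t ^ (α - 1) / 2) ≤ Hop α h s := by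
    intro s hs
    calc ENNReal.ofReal (t ^ (α - 1) / 2) = ∫⁻ r in Ioo t (t + 1), ENNReal.ofReal (t ^ (α - 1) / 2) := by
          rw [setLIntegral_const]; simp
      _ ≤ ∫⁻ r in Ioo t (t + 1), h r * ENNReal.ofReal (r ^ (α - 1)) := by
          refine setLIntegral_mono (hhm.mul (by fun_prop)) ?_
          intro r hr
          simp only [hh, indicator_of_mem hr, Pi.one_apply, one_mul]
          apply ENNReal.ofReal_le_ofReal
          have hr0 : 0 < r := ht0.trans hr.1
          calc t ^ (α - 1) / 2 = t ^ (α - 1) * 2 ^ (-1 : ℝ) := by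
                rw [Real.rpow_neg_one]; ring
            _ ≤ t ^ (α - 1) * 2 ^ (α - 1) := by
                gcongr
                · norm_num
                · linarith
            _ = (t * 2) ^ (α - 1) := by rw [Real.mul_rpow ht0.le (by norm_num)]
            _ ≤ r ^ (α - 1) := Real.rpow_le_rpow_of_nonpos hr0 (by linarith [hr.2]) (by linarith)
      _ ≤ _ := by
          apply lintegral_mono_set
          intro r hr; exact hs.2.trans hr.1
  have hmain : ENNReal.ofReal (t ^ (α - 1) / 2) * ρ ((Ioo (0:ℝ) t).indicator 1) ≤ ρ (Hop α h) := by
    have := hY.smul (t ^ (α - 1) / 2).toNNReal _ (hi1 t)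
    refine (le_of_eq this.symm).trans ?_
    refine hY.mono _ _ ((hi1 t).const_mul _) (Hop_antitone α _).measurable ?_
    refine Filter.Eventually.of_forall fun s => ?_
    by_cases hs : s ∈ Ioo 0 t
    · rw [indicator_of_mem hs, Pi.one_apply, mul_one]; exact hlow s hs
    · rw [indicator_of_notMem hs]; simp
  have e := hmain.trans ((hC h hhm).trans (mul_le_mul' le_rfl hρ))
  calc ρ ((Ioo (0:ℝ) t).indicator 1)
      = ENNReal.ofReal (2 * t ^ (1 - α)) * (ENNReal.ofReal (t ^ (α - 1) / 2) * ρ ((Ioo (0:ℝ) t).indicator 1)) := by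
        rw [← mul_assoc, ← ENNReal.ofReal_mul (by positivity)]
        rw [show 2 * t ^ (1 - α) * (t ^ (α - 1) / 2) = t ^ (1 - α) * t ^ (α - 1) by ring,
          ← Real.rpow_add ht0]
        simp
    _ ≤ ENNReal.ofReal (2 * t ^ (1 - α)) * _ := mul_le_mul' le_rfl e
    _ = _ := by
        rw [ENNReal.ofReal_mul (by norm_num)]; simp only [ENNReal.ofReal_ofNat]; ring


lemma lint_mu0 (f : ℝ → ℝ≥0∞) : ∫⁻ x, f x ∂mu0 = ∫⁻ x, (Ioi (0:ℝ)).indicator f x := by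
  rw [lintegral_indicator measurableSet_Ioi]; rfl

lemma stepA (α : ℝ) (h1 : α < 1) (h0 : 0 < α) (ρ : (ℝ → ℝ≥0∞) → ℝ≥0∞) (hY : IsRINorm ρ)
    (C : ℝ≥0∞) (hCt : C ≠ ∞)
    (hC : ∀ h : ℝ → ℝ≥0∞, Measurable h → ρ (Hop α h) ≤ C * ρ (Hop α (rearr h)))
    (f h : ℝ → ℝ≥0∞) (hf : Measurable f) (hh : Measurable h) (hha : Antitone h)
    (D : ℝ≥0∞) (hDt : D ≠ ∞) (hD : ρ (Hop α h) ≤ D) :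
    ∫⁻ x, h x * Nf α f x ∂mu0 ≤ 36 * (36 * (C * D * associate ρ f)) := by
  refine dyadic h (Nf α f) (fun t => ENNReal.ofReal (t ^ (α - 1)) * Fi f t) (hha.antitoneOn _)
    ((Nf_antitone α f).antitoneOn _) hh (Nf_antitone α f).measurable ?_ _ ?_
  · intro j θ hθ
    simp only [Nf, lt_iSup_iff] at hθ
    obtain ⟨t, ht, hθ⟩ := hθ
    have h4 : (0:ℝ) < 4 ^ j := by positivity
    have ht0 : 0 < t := h4.trans_le ht
    refine ⟨Ico t (t + 4 ^ j / 2), measurableSet_Ico, ?_, ?_⟩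
    · rw [mu0_apply_inter _ measurableSet_Ico, inter_eq_left.2, Real.volume_Ico]
      · congr 1; ring
      · intro x hx; exact ht0.trans_le hx.1
    · intro x hx
      have hx0 : 0 < x := ht0.trans_le hx.1
      refine hθ.le.trans ?_
      have hr : t ^ (α - 1) ≤ 2 * x ^ (α - 1) := by
        calc t ^ (α - 1) = 2 * (t ^ (α - 1) * 2 ^ (-1 : ℝ)) := by
              rw [Real.rpow_neg_one]; ring
          _ ≤ 2 * (t ^ (α - 1) * 2 ^ (α - 1)) := by
              gcongr
              · norm_num
              · linarith
          _ = 2 * (t * 2) ^ (α - 1) := by rw [Real.mul_rpow ht0.le (by norm_num)]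
          _ ≤ 2 * x ^ (α - 1) := by
              refine mul_le_mul_of_nonneg_left ?_ (by norm_num)
              exact Real.rpow_le_rpow_of_nonpos hx0 (by linarith [hx.2]) (by linarith)
      calc ENNReal.ofReal (t ^ (α - 1)) * Fi f t
          ≤ ENNReal.ofReal (2 * x ^ (α - 1)) * Fi f x :=
            mul_le_mul' (ENNReal.ofReal_le_ofReal hr) (Fi_mono f hx.1)
        _ = _ := by
            rw [ENNReal.ofReal_mul (by norm_num)]; simp only [ENNReal.ofReal_ofNat]; ring
  · intro v hv hvh
    have hle : ρ (Hop α v) ≤ C * D := by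
      refine (hC v hv).trans (mul_le_mul' le_rfl (le_trans ?_ hD))
      refine hY.mono _ _ (Hop_antitone α _).measurable (Hop_antitone α _).measurable ?_
      filter_upwards [ae_pos] with s hs
      refine setLIntegral_mono (hh.mul (by fun_prop)) ?_
      intro r hr
      exact mul_le_mul' (hvh r (lt_trans hs hr)) le_rfl
    calc ∫⁻ x, v x * (ENNReal.ofReal (x ^ (α - 1)) * Fi f x) ∂mu0
        = ∫⁻ t, rearr f t * Hop α v t ∂mu0 := (fub α (rearr f) v (rearr_meas f) hv).symm
      _ = ∫⁻ t, Hop α v t * rearr f t ∂mu0 := by simp_rw [mul_comm]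
      _ ≤ 36 * (ρ (Hop α v) * associate ρ f) :=
          test_rearr hY f _ hf (Hop_antitone α v).measurable ((Hop_antitone α v).antitoneOn _)
            (ne_top_of_le_ne_top (ENNReal.mul_ne_top hCt hDt) hle)
      _ ≤ _ := mul_le_mul' le_rfl (mul_le_mul' hle le_rfl)

lemma stepB (α : ℝ) (h0 : 0 < α) (h1 : α < 1) (f g : ℝ → ℝ≥0∞) (hg : Measurable g)
    (hgfin : ∀ l : ℝ, 0 < l → mu0 {x | ENNReal.ofReal l < g x} ≠ ∞) :
    ∃ h : ℝ → ℝ≥0∞, Antitone h ∧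
      (∀ s, 0 < s → Hop α h s ≤ ENNReal.ofReal (1 / α) * rearr g s) ∧
      ∫⁻ x, g x * supOp α f x ∂mu0 ≤ ENNReal.ofReal (5 / (1 - α)) * ∫⁻ x, h x * Nf α f x ∂mu0 := by
  set A : ℝ → ℝ := fun l => (mu0 {x | ENNReal.ofReal l < g x}).toReal with hA
  have hAm : Measurable A := by
    refine Measurable.ennreal_toReal ?_
    apply Antitone.measurable
    intro l l' hl
    apply measure_mono
    intro x hx
    exact lt_of_le_of_lt (ENNReal.ofReal_le_ofReal hl) hx
  have hA0 : ∀ l, 0 ≤ A l := fun l => ENNReal.toReal_nonneg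
  set D : Set (ℝ × ℝ) := {q | 0 < q.1 ∧ q.2 < A q.1} with hD
  have hDm : MeasurableSet D :=
    (measurableSet_lt measurable_const measurable_fst).inter
      (measurableSet_lt measurable_snd (hAm.comp measurable_fst))
  set p : ℝ → ℝ≥0∞ := fun l => ENNReal.ofReal (A l ^ (-α)) with hp
  have hpm : Measurable p := by
    simp only [hp]; fun_prop
  set h : ℝ → ℝ≥0∞ := fun s => ∫⁻ l in {l | (l, s) ∈ D}, p l with hh
  have hha : Antitone h := by
    intro s s' hs
    refine lintegral_mono_set ?_
    rintro l ⟨a1, a2⟩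
    exact ⟨a1, lt_of_le_of_lt hs a2⟩
  have hsec : ∀ l, 0 < l → {s | (l, s) ∈ D} = Iio (A l) := by
    intro l hl; ext s; simp [hD, hl]
  have hsec0 : ∀ l, ¬ 0 < l → {s | (l, s) ∈ D} = ∅ := by
    intro l hl; ext s; simp [hD, hl]
  refine ⟨h, hha, ?_, ?_⟩
  · intro s hs
    have hq : Measurable (fun r : ℝ => ENNReal.ofReal (r ^ (α - 1))) := by fun_prop
    have ht := tonelli D hDm p ((Ioi s).indicator fun r => ENNReal.ofReal (r ^ (α - 1))) hpm
      (hq.indicator measurableSet_Ioi)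
    calc Hop α h s = ∫⁻ r, (Ioi s).indicator (fun r => ENNReal.ofReal (r ^ (α - 1))) r * h r := by
          unfold Hop
          rw [← lintegral_indicator measurableSet_Ioi]
          refine lintegral_congr fun r => ?_
          by_cases hr : r ∈ Ioi s
          · rw [indicator_of_mem hr, indicator_of_mem hr, mul_comm]
          · rw [indicator_of_notMem hr, indicator_of_notMem hr, zero_mul]
      _ = ∫⁻ l, p l * ∫⁻ u in {u | (l, u) ∈ D}, (Ioi s).indicator (fun r => ENNReal.ofReal (r ^ (α - 1))) u := ht.symm
      _ ≤ ∫⁻ l, (Ioi (0:ℝ)).indicator (fun l => ENNReal.ofReal (1 / α) *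
            {l : ℝ | ENNReal.ofReal l < rearr g s}.indicator 1 l) l := by
          refine lintegral_mono fun l => ?_
          by_cases hl : 0 < l
          · rw [hsec l hl, indicator_of_mem (show l ∈ Ioi (0:ℝ) from hl),
              lintegral_indicator measurableSet_Ioi, Measure.restrict_restrict measurableSet_Ioi,
              Ioi_inter_Iio]
            by_cases hsA : s < A l
            · have hA' : 0 < A l := hs.trans hsA
              have : l ∈ {l : ℝ | ENNReal.ofReal l < rearr g s} := by
                simp only [mem_ofPred_eq]
                rw [lt_rearr_iff, ofReal_lt_iff' _ (hgfin l hl) s hs]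
                exact hsA
              rw [indicator_of_mem this, Pi.one_apply, mul_one]
              calc p l * ∫⁻ r in Ioo s (A l), ENNReal.ofReal (r ^ (α - 1))
                  ≤ p l * ∫⁻ r in Ioo 0 (A l), ENNReal.ofReal (r ^ (α - 1)) :=
                    mul_le_mul' le_rfl (lintegral_mono_set (Ioo_subset_Ioo_left hs.le))
                _ = ENNReal.ofReal (A l ^ (-α) * (A l ^ α / α)) := by
                    rw [rint α _ h0 hA'.le, ENNReal.ofReal_mul (by positivity)]
                _ = _ := by
                    rw [← mul_div_assoc, ← Real.rpow_add hA']; simp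
                _ ≤ _ := le_rfl
            · rw [Ioo_eq_empty hsA]; simp
          · rw [hsec0 l hl]; simp
      _ = _ := by
          rw [lintegral_indicator measurableSet_Ioi, lintegral_const_mul' _ _ ENNReal.ofReal_ne_top,
            layer_pt]
  · have hNm := (Nf_antitone α f).measurable
    have ht := tonelli D hDm p ((Ioi (0:ℝ)).indicator (Nf α f)) hpm (hNm.indicator measurableSet_Ioi)
    have hr : ∫⁻ x, h x * Nf α f x ∂mu0 = ∫⁻ u, (Ioi (0:ℝ)).indicator (Nf α f) u * h u := by
      rw [lint_mu0]
      refine lintegral_congr fun r => ?_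
      by_cases hr : r ∈ Ioi (0:ℝ)
      · rw [indicator_of_mem hr, indicator_of_mem hr, mul_comm]
      · rw [indicator_of_notMem hr, indicator_of_notMem hr, zero_mul]
    rw [hr, ← ht]
    calc ∫⁻ x, g x * supOp α f x ∂mu0 ≤ ∫⁻ x, rearr g x * supOp α f x ∂mu0 :=
          HL g _ hg (supOp_meas α f) (supOp_antitone α h0 f)
      _ = ∫⁻ l in Ioi (0:ℝ), ∫⁻ x in {x | ENNReal.ofReal l < rearr g x}, supOp α f x ∂mu0 :=
          layer_cake _ _ (rearr_meas g) (supOp_meas α f)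
      _ ≤ ∫⁻ l in Ioi (0:ℝ), ENNReal.ofReal (5 / (1 - α)) * (p l *
            ∫⁻ u in {u | (l, u) ∈ D}, (Ioi (0:ℝ)).indicator (Nf α f) u) := by
          refine lintegral_mono_ae ?_
          filter_upwards [ae_restrict_mem measurableSet_Ioi] with l hl
          have hl : 0 < l := hl
          rw [hsec l hl, lintegral_indicator measurableSet_Ioi,
            Measure.restrict_restrict measurableSet_Ioi, Ioi_inter_Iio, rearr_level]
          have hset : (mu0.restrict {s : ℝ | ENNReal.ofReal s < mu0 {x | ENNReal.ofReal l < g x}}) =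
              volume.restrict (Ioo 0 (A l)) := by
            unfold mu0
            rw [Measure.restrict_restrict (meas_init _)]
            congr 1
            ext s
            constructor
            · rintro ⟨b1, b2⟩
              exact ⟨b2, (ofReal_lt_iff' _ (hgfin l hl) s b2).1 b1⟩
            · rintro ⟨b1, b2⟩
              exact ⟨(ofReal_lt_iff' _ (hgfin l hl) s b1).2 b2, b1⟩
          rw [hset]
          rcases (hA0 l).eq_or_lt with hAl | hAl
          · rw [← hAl]; simp
          · refine (supOp_int α h0 h1 f (A l) hAl).trans (mul_le_mul' le_rfl ?_)
            calc ENNReal.ofReal (A l ^ (1 - α)) * Nf α f (A l)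
                = p l * ∫⁻ x in Ioo 0 (A l), Nf α f (A l) := by
                  rw [setLIntegral_const, Real.volume_Ioo, sub_zero, mul_comm (Nf α f (A l)),
                    ← mul_assoc]
                  congr 1
                  simp only [hp]
                  rw [← ENNReal.ofReal_mul (by positivity)]
                  congr 1
                  rw [show 1 - α = -α + 1 by ring, Real.rpow_add_one hAl.ne']
              _ ≤ _ := by
                  refine mul_le_mul' le_rfl (setLIntegral_mono hNm ?_)
                  intro x hx
                  exact Nf_antitone α f hx.2.le
      _ ≤ _ := by
          rw [lintegral_const_mul' _ _ ENNReal.ofReal_ne_top]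
          exact mul_le_mul' le_rfl (setLIntegral_le_lintegral _ _)

lemma dir2 (α : ℝ) (h0 : 0 < α) (h1 : α < 1) (ρ : (ℝ → ℝ≥0∞) → ℝ≥0∞) (hY : IsRINorm ρ)
    (C : ℝ≥0∞) (hCt : C ≠ ∞)
    (hC : ∀ h : ℝ → ℝ≥0∞, Measurable h → ρ (Hop α h) ≤ C * ρ (Hop α (rearr h)))
    (f : ℝ → ℝ≥0∞) (hf : Measurable f) :
    associate ρ (supOp α f) ≤
      (ENNReal.ofReal (5 / (1 - α)) * (36 * (36 * (C * ENNReal.ofReal (1 / α))))) * associate ρ f := by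
  refine associate_le _ _ ?_
  intro u hu hu1
  have hFm : ∀ k : ℕ, Measurable ((Iic (k:ℝ)).indicator u) := fun k => hu.indicator measurableSet_Iic
  have hsup : ∫⁻ t, u t * supOp α f t ∂mu0 =
      ⨆ k : ℕ, ∫⁻ t, (Iic (k:ℝ)).indicator u t * supOp α f t ∂mu0 := by
    rw [← lintegral_iSup (f := fun (k : ℕ) t => (Iic (k:ℝ)).indicator u t * supOp α f t)
      (fun k => (hFm k).mul (supOp_meas α f))]
    · refine lintegral_congr fun t => ?_
      apply le_antisymm
      · obtain ⟨k, hk⟩ := exists_nat_ge t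
        refine le_iSup_of_le k ?_
        rw [indicator_of_mem (show t ∈ Iic (k:ℝ) from hk)]
      · exact iSup_le fun k => mul_le_mul' (indicator_le_self _ _ _) le_rfl
    · intro k k' hk t
      refine mul_le_mul' ?_ le_rfl
      exact indicator_le_indicator_of_subset (Iic_subset_Iic.2 (by exact_mod_cast hk)) (fun _ => zero_le) t
  rw [hsup]
  refine iSup_le fun k => ?_
  set g := (Iic (k:ℝ)).indicator u with hgdef
  have hg1 : ρ g ≤ 1 := by
    refine le_trans (hY.mono _ _ (hFm k) hu (Filter.Eventually.of_forall fun t => ?_)) hu1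
    exact indicator_le_self _ _ _
  have hgfin : ∀ l : ℝ, 0 < l → mu0 {x | ENNReal.ofReal l < g x} ≠ ∞ := by
    intro l hl
    refine ne_top_of_le_ne_top (b := mu0 (Iic (k:ℝ))) ?_ (measure_mono ?_)
    · rw [mu0_apply_inter _ measurableSet_Iic, inter_comm, Ioi_inter_Iic, Real.volume_Ioc]
      exact ENNReal.ofReal_ne_top
    · intro x hx
      by_contra hx'
      simp only [mem_ofPred_eq, hgdef, indicator_of_notMem hx'] at hx
      exact not_lt_zero hx
  obtain ⟨h, hha, hH, hIeq⟩ := stepB α h0 h1 f g (hFm k) hgfin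
  have hD : ρ (Hop α h) ≤ ENNReal.ofReal (1 / α) := by
    calc ρ (Hop α h) ≤ ρ (fun t => (((1 / α).toNNReal : ℝ≥0) : ℝ≥0∞) * rearr g t) := by
          refine hY.mono _ _ (Hop_antitone α _).measurable ((rearr_meas g).const_mul _) ?_
          filter_upwards [ae_pos] with s hs
          exact hH s hs
      _ = ENNReal.ofReal (1 / α) * ρ (rearr g) := hY.smul _ _ (rearr_meas g)
      _ = ENNReal.ofReal (1 / α) * ρ g := by rw [rho_rearr hY g (hFm k)]
      _ ≤ ENNReal.ofReal (1 / α) * 1 := mul_le_mul' le_rfl hg1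
      _ = _ := mul_one _
  refine hIeq.trans ?_
  refine (mul_le_mul' le_rfl (stepA α h1 h0 ρ hY C hCt hC f h hf hha.measurable hha _
    ENNReal.ofReal_ne_top hD)).trans (le_of_eq ?_)
  ring

/-- simplification of the optimal domain norm via the operator `T_{m/n}`. -/
theorem statement8 (n m : ℕ) (hn : 2 ≤ n) (hm : 1 ≤ m) (hmn : m < n)
    (ρY : (ℝ → ℝ≥0∞) → ℝ≥0∞) (hY : IsRINorm ρY) :
    ((∃ K : ℝ≥0∞, K < ∞ ∧ ∀ f : ℝ → ℝ≥0∞, Measurable f →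
        associate ρY (supOp ((m : ℝ)/(n : ℝ)) f) ≤ K * associate ρY f) →
      (0 < ⨅ (t : ℝ) (_ : 1 ≤ t),
          ENNReal.ofReal (t ^ (1 - (m : ℝ)/(n : ℝ))) / ρY ((Set.Ioo (0:ℝ) t).indicator 1))
      ∧ ∃ c C : ℝ≥0∞, 0 < c ∧ c < ∞ ∧ 0 < C ∧ C < ∞ ∧
          ∀ f : ℝ → ℝ≥0∞, Measurable f →
            c * ρY (hardyOp m n (rearr f)) ≤ tauFun m n ρY f
            ∧ tauFun m n ρY f ≤ C * ρY (hardyOp m n (rearr f)))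
    ∧
    (¬ (∃ K : ℝ≥0∞, K < ∞ ∧ ∀ f : ℝ → ℝ≥0∞, Measurable f →
        associate ρY (supOp ((m : ℝ)/(n : ℝ)) f) ≤ K * associate ρY f) →
      ¬ ∃ c C : ℝ≥0∞, 0 < c ∧ c < ∞ ∧ 0 < C ∧ C < ∞ ∧
          ∀ f : ℝ → ℝ≥0∞, Measurable f →
            c * ρY (hardyOp m n (rearr f)) ≤ tauFun m n ρY f
            ∧ tauFun m n ρY f ≤ C * ρY (hardyOp m n (rearr f))) := by
  have hn0 : (0:ℝ) < n := by exact_mod_cast (by omega : 0 < n)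
  have hm0 : (0:ℝ) < m := by exact_mod_cast (by omega : 0 < m)
  have h0 : 0 < (m:ℝ) / n := by positivity
  have h1 : (m:ℝ) / n < 1 := by rw [div_lt_one hn0]; exact_mod_cast hmn
  have hop : ∀ f, hardyOp m n f = Hop ((m:ℝ) / n) f := fun f => rfl
  constructor
  · rintro ⟨K, hKt, hK⟩
    have hC := Hop_rearr_bound _ h0 h1 ρY hY K hK
    have hCt : 2 * K + 1 < ∞ :=
      ENNReal.add_lt_top.2 ⟨ENNReal.mul_lt_top (by norm_num) hKt, by norm_num⟩
    refine ⟨?_, 1, 2 * K + 1, by norm_num, by norm_num, by positivity, hCt, ?_⟩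
    · set M := 2 * (2 * K + 1) * (ENNReal.ofReal (1 / ((m:ℝ) / n)) * ρY ((Ioo (0:ℝ) 1).indicator 1))
        with hM
      have hMt : M ≠ ∞ := by
        refine ENNReal.mul_ne_top (ENNReal.mul_ne_top (by norm_num) hCt.ne)
          (ENNReal.mul_ne_top ENNReal.ofReal_ne_top
            (hY.indicator_lt_top _ measurableSet_Ioo ?_).ne)
        rw [mu0_apply_inter _ measurableSet_Ioo]
        exact (measure_mono inter_subset_left).trans_lt (by simp)
      refine lt_of_lt_of_le (b := (M + 1)⁻¹)
        (ENNReal.inv_pos.2 (ENNReal.add_ne_top.2 ⟨hMt, by norm_num⟩)) ?_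
      refine le_iInf fun t => le_iInf fun ht => ?_
      have hb := phi_bound _ h0 h1 ρY hY _ hC t ht
      have ht0 : 0 < t ^ (1 - (m:ℝ) / n) := by
        have : 0 < t := by linarith
        positivity
      have hx0 : ENNReal.ofReal (t ^ (1 - (m:ℝ) / n)) ≠ 0 := by simpa using ht0
      have hb' : ρY ((Ioo (0:ℝ) t).indicator 1) ≤ ENNReal.ofReal (t ^ (1 - (m:ℝ) / n)) * (M + 1) :=
        hb.trans (mul_le_mul' le_rfl le_self_add)
      calc (M + 1)⁻¹ = ENNReal.ofReal (t ^ (1 - (m:ℝ) / n)) /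
            (ENNReal.ofReal (t ^ (1 - (m:ℝ) / n)) * (M + 1)) := by
            rw [ENNReal.div_eq_inv_mul, ENNReal.mul_inv (Or.inl hx0) (Or.inl ENNReal.ofReal_ne_top),
              mul_comm, ← mul_assoc, ENNReal.mul_inv_cancel hx0 ENNReal.ofReal_ne_top, one_mul]
        _ ≤ _ := ENNReal.div_le_div_left hb' _
    · intro f hf
      constructor
      · rw [one_mul]
        exact le_iSup_of_le (rearr f) (le_iSup_of_le (rearr_meas f)
          (le_iSup_of_le (rearr_rearr f) le_rfl))
      · refine iSup_le fun h => iSup_le fun hh => iSup_le fun hr => ?_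
        rw [← hr, hop, hop]
        exact hC h hh
  · intro hnot
    rintro ⟨c, C, -, -, -, hCt, hE⟩
    apply hnot
    refine ⟨_, ?_, dir2 _ h0 h1 ρY hY C hCt.ne ?_⟩
    · refine ENNReal.mul_lt_top ENNReal.ofReal_lt_top (ENNReal.mul_lt_top (by norm_num)
        (ENNReal.mul_lt_top (by norm_num) (ENNReal.mul_lt_top hCt ENNReal.ofReal_lt_top)))
    · intro h hh
      refine le_trans ?_ (hE h hh).2
      exact le_iSup_of_le h (le_iSup_of_le hh (le_iSup_of_le rfl le_rfl))

end
end

section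
/- Let n ≥ 2, 1 ≤ m < n, q ∈ [1,∞], A = [α₀,α_∞] ∈ ℝ², and p ∈ [1,n/m], and assume one of: (p=q=1, α₀≥0, α_∞≤0), or p∈(1,n/m]. Let p', q' be the conjugate exponents of p and q. Then there exist constants c, C > 0, depending only on p, q, A, m, n, such that for every measurable function f on (0,∞): c · ‖t^{1/p'−1/q'+m/n} ℓ^{−A}(t) f^{**}(t)‖_{L^{q'}(0,∞)} ≤ ‖t^{1/p'−1/q'} ℓ^{−A}(t) h^*(t)‖_{L^{q'}(0,∞)} ≤ C · ‖t^{1/p'−1/q'+m/n} ℓ^{−A}(t) f^{**}(t)‖_{L^{q'}(0,∞)}, where h denotes the function h(τ) = τ^{m/n} f^{**}(τ) and h^* is its decreasing rearrangement. In other words, the functional f ↦ ‖τ^{m/n} f^{**}(τ)‖_{L^{p',q';−A}(0,∞)} is equivalent to the norm of f in L^{(np'/(n+mp'), q'; −A)} given by ‖t^{1/p'−1/q'+m/n} ℓ^{−A}(t) f^{**}(t)‖_{L^{q'}(0,∞)} (with np'/(n+mp') interpreted as n/m when p = 1). -/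
open MeasureTheory Set Filter
open scoped ENNReal NNReal Topology

noncomputable section

/-- Conjugate exponent in `[1,∞]`, with `1' = ∞` and `∞' = 1`. -/
def conjExp (q : ℝ≥0∞) : ℝ≥0∞ :=
  if q = 1 then ∞ else if q = ∞ then 1 else ENNReal.ofReal (q.toReal / (q.toReal - 1))

lemma ell_pos (b0 bi : ℝ) {t : ℝ} (ht : 0 < t) : 0 < ell b0 bi t := by
  unfold ell
  split_ifs with h
  · have := Real.log_neg ht h
    exact Real.rpow_pos_of_pos (by linarith) _
  · have := Real.log_nonneg (not_lt.mp h)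
    exact Real.rpow_pos_of_pos (by linarith) _

lemma ell_measurable (b0 bi : ℝ) : Measurable (ell b0 bi) := by
  unfold ell
  refine Measurable.ite measurableSet_Iio ?_ ?_
  · exact (measurable_const.sub Real.measurable_log).pow_const _
  · exact (measurable_const.add Real.measurable_log).pow_const _

lemma rpow_le_rpow_abs_mul {x y z b : ℝ} (hx : 0 < x) (hy : 0 < y)
    (h1 : x ≤ y * z) (h2 : y ≤ x * z) (hz : 1 ≤ z) : x ^ b ≤ y ^ b * z ^ |b| := by
  have hz0 : 0 < z := by linarith
  rcases le_total 0 b with hb | hb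
  · rw [abs_of_nonneg hb, ← Real.mul_rpow hy.le hz0.le]
    exact Real.rpow_le_rpow hx.le h1 hb
  · rw [abs_of_nonpos hb, Real.rpow_neg hz0.le, ← div_eq_mul_inv, ← Real.div_rpow hy.le hz0.le]
    apply Real.rpow_le_rpow_of_nonpos (by positivity) _ hb
    rw [div_le_iff₀ hz0]; exact h2

lemma ell_ratio (b0 bi : ℝ) {t s : ℝ} (ht : 0 < t) (hts : t ≤ s) :
    ell b0 bi t ≤ ell b0 bi s * (1 + Real.log (s / t)) ^ (|b0| + |bi|) := by
  have hs : 0 < s := ht.trans_le hts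
  have hl : Real.log t ≤ Real.log s := Real.log_le_log ht hts
  have hd : Real.log (s / t) = Real.log s - Real.log t := Real.log_div hs.ne' ht.ne'
  set z := 1 + Real.log (s / t) with hz
  have hz1 : 1 ≤ z := by linarith
  have hz0 : 0 < z := by linarith
  have e0 : z ^ |b0| ≤ z ^ (|b0| + |bi|) :=
    Real.rpow_le_rpow_of_exponent_le hz1 (by linarith [abs_nonneg bi])
  have e1 : z ^ |bi| ≤ z ^ (|b0| + |bi|) :=
    Real.rpow_le_rpow_of_exponent_le hz1 (by linarith [abs_nonneg b0])
  have hsp := ell_pos b0 bi hs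
  unfold ell at *
  by_cases h1 : s < 1
  · have h2 : t < 1 := by linarith
    have := Real.log_neg hs h1
    have := Real.log_neg ht h2
    simp only [h1, h2, if_true] at *
    refine (rpow_le_rpow_abs_mul (z := z) (by linarith) (by linarith) ?_ ?_ hz1).trans
      (mul_le_mul_of_nonneg_left e0 hsp.le)
    · nlinarith
    · nlinarith
  · have h1' := Real.log_nonneg (not_lt.mp h1)
    by_cases h2 : t < 1
    · have := Real.log_neg ht h2
      simp only [h1, h2, if_true, if_false] at *
      have a1 := rpow_le_rpow_abs_mul (x := 1 - Real.log t) (y := 1) (z := z) (b := b0)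
        (by linarith) one_pos (by linarith) (by nlinarith) hz1
      have a2 := rpow_le_rpow_abs_mul (x := 1) (y := 1 + Real.log s) (z := z) (b := bi)
        one_pos (by linarith) (by nlinarith) (by linarith) hz1
      rw [Real.one_rpow] at a1 a2
      rw [Real.rpow_add hz0]
      have : 0 < z ^ |b0| := Real.rpow_pos_of_pos hz0 _
      nlinarith
    · have h2' := Real.log_nonneg (not_lt.mp h2)
      simp only [h1, h2, if_false] at *
      refine (rpow_le_rpow_abs_mul (z := z) (by linarith) (by linarith) ?_ ?_ hz1).trans
        (mul_le_mul_of_nonneg_left e1 hsp.le)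
      · nlinarith
      · nlinarith

lemma log_pow_bound (N ε : ℝ) (hN : 0 ≤ N) (hε : 0 < ε) :
    ∃ K : ℝ, 0 < K ∧ ∀ x : ℝ, 1 ≤ x → (1 + Real.log x) ^ N ≤ K * x ^ ε := by
  have hδ : 0 < ε / (N + 1) := by positivity
  set δ := ε / (N + 1) with hd
  refine ⟨(1 + 1 / δ) ^ N, by positivity, fun x hx => ?_⟩
  have hx0 : 0 < x := by linarith
  have h1 := Real.log_le_rpow_div hx0.le hδ
  have h2 : 1 ≤ x ^ δ := Real.one_le_rpow hx hδ.le
  have h0 := Real.log_nonneg hx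
  have h3 : 1 + Real.log x ≤ (1 + 1 / δ) * x ^ δ := by
    have : (1 + 1 / δ) * x ^ δ = x ^ δ + x ^ δ / δ := by ring
    linarith
  calc (1 + Real.log x) ^ N ≤ ((1 + 1 / δ) * x ^ δ) ^ N :=
        Real.rpow_le_rpow (by linarith) h3 hN
    _ = (1 + 1 / δ) ^ N * x ^ (δ * N) := by
        rw [Real.mul_rpow (by positivity) (by positivity), ← Real.rpow_mul hx0.le]
    _ ≤ _ := by
        gcongr
        rw [hd, div_mul_eq_mul_div, div_le_iff₀ (by linarith)]; nlinarith

lemma quasi_incr (β b0 bi : ℝ) (hβ : 0 < β) :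
    ∃ K : ℝ, 0 < K ∧ ∀ t s : ℝ, 0 < t → t ≤ s →
      t ^ β * ell b0 bi t ≤ K * (s ^ β * ell b0 bi s) := by
  obtain ⟨K, hK, h⟩ := log_pow_bound (|b0| + |bi|) β (by positivity) hβ
  refine ⟨K, hK, fun t s ht hts => ?_⟩
  have hs : 0 < s := ht.trans_le hts
  have h1 := ell_ratio b0 bi ht hts
  have h2 := h (s / t) ((one_le_div ht).mpr hts)
  have hp := ell_pos b0 bi hs
  have ht' : 0 < t ^ β := Real.rpow_pos_of_pos ht _
  rw [Real.div_rpow hs.le ht.le] at h2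
  calc t ^ β * ell b0 bi t ≤ t ^ β * (ell b0 bi s * (K * (s ^ β / t ^ β))) := by
        gcongr
        exact h1.trans (mul_le_mul_of_nonneg_left h2 hp.le)
    _ = _ := by field_simp

lemma quasi_incr_zero (b0 bi : ℝ) (h0 : b0 ≤ 0) (hi : 0 ≤ bi) {t s : ℝ} (ht : 0 < t)
    (hts : t ≤ s) : ell b0 bi t ≤ ell b0 bi s := by
  have hs : 0 < s := ht.trans_le hts
  have hl : Real.log t ≤ Real.log s := Real.log_le_log ht hts
  unfold ell
  by_cases h1 : s < 1
  · have h2 : t < 1 := by linarith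
    have := Real.log_neg hs h1
    simp only [h1, h2, if_true]
    exact Real.rpow_le_rpow_of_nonpos (by linarith) (by linarith) h0
  · have h1' := Real.log_nonneg (not_lt.mp h1)
    by_cases h2 : t < 1
    · have := Real.log_neg ht h2
      simp only [h1, h2, if_true, if_false]
      exact (Real.rpow_le_one_of_one_le_of_nonpos (by linarith) h0).trans
        (Real.one_le_rpow (by linarith) hi)
    · have h2' := Real.log_nonneg (not_lt.mp h2)
      simp only [h1, h2, if_false]
      exact Real.rpow_le_rpow (by linarith) (by linarith) hi

lemma Lq_le {r c : ℝ≥0∞} (hc : c ≠ ∞) (hr : r ≠ 0) {u v : ℝ → ℝ≥0∞}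
    (h : ∀ t, 0 < t → u t ≤ c * v t) :
    Lqnorm r (Set.Ioi 0) u ≤ c * Lqnorm r (Set.Ioi 0) v := by
  unfold Lqnorm
  split_ifs with hri
  · rw [← ENNReal.essSup_const_mul]
    refine essSup_mono_ae ?_
    filter_upwards [ae_restrict_mem measurableSet_Ioi] with t ht
    exact h t ht
  · have hr0 : 0 < r.toReal := ENNReal.toReal_pos hr hri
    have : (∫⁻ t in Ioi (0:ℝ), u t ^ r.toReal) ≤ c ^ r.toReal * ∫⁻ t in Ioi (0:ℝ), v t ^ r.toReal := by
      rw [← lintegral_const_mul' _ _ (ENNReal.rpow_ne_top_of_nonneg hr0.le hc)]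
      apply setLIntegral_mono' measurableSet_Ioi
      intro t ht
      rw [← ENNReal.mul_rpow_of_nonneg _ _ hr0.le]
      exact ENNReal.rpow_le_rpow (h t ht) hr0.le
    refine (ENNReal.rpow_le_rpow this (by positivity)).trans (le_of_eq ?_)
    rw [ENNReal.mul_rpow_of_nonneg _ _ (by positivity), ← ENNReal.rpow_mul,
      mul_one_div_cancel hr0.ne', ENNReal.rpow_one]

lemma le_rearr {g : ℝ → ℝ≥0∞} (H : ∀ t τ, 0 < t → t ≤ τ → τ ≤ 3 * t → g t ≤ 3 * g τ)
    {t : ℝ} (ht : 0 < t) : g t ≤ 3 * rearr g t := by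
  have h3 : (3:ℝ≥0∞) ≠ 0 := by norm_num
  have h3' : (3:ℝ≥0∞) ≠ ∞ := by norm_num
  suffices hs : g t / 3 ≤ rearr g t by
    rwa [ENNReal.div_le_iff_le_mul (Or.inl h3) (Or.inl h3'), mul_comm] at hs
  apply le_sInf
  intro l hl
  have hl : mu0 {x | l < g x} ≤ ENNReal.ofReal t := hl
  by_contra hcon
  push Not at hcon
  have hsub : Icc t (3 * t) ⊆ {x | l < g x} ∩ Ioi 0 := by
    intro τ hτ
    refine ⟨?_, ht.trans_le hτ.1⟩
    refine hcon.trans_le ?_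
    rw [ENNReal.div_le_iff_le_mul (Or.inl h3) (Or.inl h3'), mul_comm]
    exact H t τ ht hτ.1 hτ.2
  have h4 := measure_mono (μ := volume) hsub
  unfold mu0 at hl
  rw [Measure.restrict_apply' measurableSet_Ioi] at hl
  have h5 := h4.trans hl
  rw [Real.volume_Icc, ENNReal.ofReal_le_ofReal_iff ht.le] at h5
  linarith

lemma rearr_le_s10 {g : ℝ → ℝ≥0∞} {t : ℝ} {l : ℝ≥0∞} (h : ∀ s, t ≤ s → g s ≤ l) :
    rearr g t ≤ l := by
  apply sInf_le
  show mu0 {x | l < g x} ≤ ENNReal.ofReal t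
  unfold mu0
  rw [Measure.restrict_apply' measurableSet_Ioi]
  calc volume ({x | l < g x} ∩ Ioi 0) ≤ volume (Ioo 0 t) := by
        apply measure_mono
        rintro x ⟨hx, hx0⟩
        refine ⟨hx0, ?_⟩
        by_contra hh
        exact absurd (h x (not_lt.mp hh)) (not_le.mpr hx)
    _ = _ := by simp

lemma upper_top {g : ℝ → ℝ≥0∞} {W : ℝ → ℝ≥0∞} {K : ℝ≥0∞}
    (H : ∀ t τ, 0 < t → t ≤ τ → τ ≤ 3 * t → g t ≤ 3 * g τ)
    (hW : ∀ t s, 0 < t → t ≤ s → W t ≤ K * W s) :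
    essSup (fun t => W t * rearr g t) (volume.restrict (Ioi 0)) ≤
      (3 * K) * essSup (fun t => W t * g t) (volume.restrict (Ioi 0)) := by
  set M := essSup (fun t => W t * g t) (volume.restrict (Ioi 0)) with hM
  have key : ∀ t s, 0 < t → t ≤ s → W t * g s ≤ 3 * K * M := by
    intro t s ht hts
    have hs : 0 < s := ht.trans_le hts
    have hae : ∀ᵐ τ ∂(volume.restrict (Ioi (0:ℝ))), W τ * g τ ≤ M := ENNReal.ae_le_essSup _
    have : ∃ τ ∈ Ioo s (3 * s), W τ * g τ ≤ M := by
      by_contra hcon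
      push Not at hcon
      have h0 : (volume.restrict (Ioi (0:ℝ))) (Ioo s (3 * s)) = 0 := by
        refine measure_mono_null ?_ hae
        intro τ hτ
        exact not_le.mpr (hcon τ hτ)
      rw [Measure.restrict_apply measurableSet_Ioo, inter_eq_left.mpr, Real.volume_Ioo,
        ENNReal.ofReal_eq_zero] at h0
      · linarith
      · intro x hx; exact hs.trans hx.1
    obtain ⟨τ, hτ, hle⟩ := this
    calc W t * g s ≤ (K * W τ) * (3 * g τ) :=
          mul_le_mul' (hW t τ ht (hts.trans hτ.1.le)) (H s τ hs hτ.1.le hτ.2.le)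
      _ = 3 * K * (W τ * g τ) := by ring
      _ ≤ _ := by gcongr
  refine essSup_le_of_ae_le _ ?_
  filter_upwards [ae_restrict_mem measurableSet_Ioi] with t ht
  have ht : 0 < t := ht
  by_cases hW0 : W t = 0
  · simp [hW0]
  by_cases hWt : W t = ∞
  · by_cases hz : ∀ s, t ≤ s → g s ≤ 0
    · have := rearr_le_s10 hz
      simp only [nonpos_iff_eq_zero] at this
      simp [this]
    · push Not at hz
      obtain ⟨s, hs, hg⟩ := hz
      have := key t s ht hs
      rw [hWt, ENNReal.top_mul hg.ne'] at this
      exact le_top.trans this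
  rw [mul_comm, ← ENNReal.le_div_iff_mul_le (Or.inl hW0) (Or.inl hWt)]
  apply rearr_le_s10
  intro s hs
  rw [ENNReal.le_div_iff_mul_le (Or.inl hW0) (Or.inl hWt), mul_comm]
  exact key t s ht hs

lemma tonelli_s10 {a b : ℝ → ℝ≥0∞} (ha : Measurable a) (hb : Measurable b) :
    ∫⁻ t in Ioi (0:ℝ), a t * ∫⁻ τ in Ioi t, b τ =
      ∫⁻ τ in Ioi (0:ℝ), b τ * ∫⁻ t in Ioo (0:ℝ) τ, a t := by
  have hS : MeasurableSet {z : ℝ × ℝ | 0 < z.1 ∧ z.1 < z.2} :=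
    (measurableSet_lt measurable_const measurable_fst).inter
      (measurableSet_lt measurable_fst measurable_snd)
  set φ : ℝ × ℝ → ℝ≥0∞ := {z : ℝ × ℝ | 0 < z.1 ∧ z.1 < z.2}.indicator
    (fun z => a z.1 * b z.2) with hφ
  have hm : Measurable φ :=
    ((ha.comp measurable_fst).mul (hb.comp measurable_snd)).indicator hS
  have h1 : ∫⁻ t in Ioi (0:ℝ), a t * ∫⁻ τ in Ioi t, b τ = ∫⁻ t, ∫⁻ τ, φ (t, τ) := by
    rw [← lintegral_indicator measurableSet_Ioi]
    congr 1; ext t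
    by_cases ht : 0 < t
    · rw [indicator_of_mem (by exact ht), ← lintegral_const_mul _ hb,
        ← lintegral_indicator measurableSet_Ioi]
      congr 1; ext τ
      simp [hφ, indicator, ht]
    · rw [indicator_of_notMem (by exact ht)]
      simp [hφ, indicator, ht]
  have h2 : ∫⁻ τ in Ioi (0:ℝ), b τ * ∫⁻ t in Ioo (0:ℝ) τ, a t = ∫⁻ τ, ∫⁻ t, φ (t, τ) := by
    rw [← lintegral_indicator measurableSet_Ioi]
    congr 1; ext τ
    by_cases ht : 0 < τ
    · rw [indicator_of_mem (by exact ht), ← lintegral_const_mul _ ha,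
        ← lintegral_indicator measurableSet_Ioo]
      congr 1; ext t
      simp [hφ, indicator, mul_comm]
    · rw [indicator_of_notMem (by exact ht)]
      symm
      rw [← lintegral_zero (μ := (volume : Measure ℝ))]
      congr 1; ext t
      simp only [hφ, indicator, mem_setOf_eq]
      rw [if_neg]
      rintro ⟨h, h'⟩
      exact ht (h.trans h')
  rw [h1, h2]
  exact lintegral_lintegral_swap hm.aemeasurable

lemma lintegral_rpow_Ioo {γ τ : ℝ} (hγ : 0 < γ) (hτ : 0 < τ) :
    ∫⁻ t in Ioo (0:ℝ) τ, ENNReal.ofReal (t ^ (γ - 1)) = ENNReal.ofReal (τ ^ γ / γ) := by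
  have hi : IntervalIntegrable (fun t : ℝ => t ^ (γ - 1)) volume 0 τ :=
    intervalIntegral.intervalIntegrable_rpow' (by linarith)
  rw [intervalIntegrable_iff_integrableOn_Ioo_of_le hτ.le] at hi
  rw [← ofReal_integral_eq_lintegral_ofReal hi]
  · congr 1
    rw [← integral_Ioc_eq_integral_Ioo, ← intervalIntegral.integral_of_le hτ.le,
      integral_rpow (Or.inl (by linarith))]
    simp [Real.zero_rpow hγ.ne']
  · filter_upwards [ae_restrict_mem measurableSet_Ioo] with t ht
    exact Real.rpow_nonneg ht.1.le _

lemma weight_int (β b0 bi r : ℝ) (hβ : 0 < β) (hr : 0 < r) :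
    ∃ C : ℝ≥0∞, C ≠ ∞ ∧ ∀ τ : ℝ, 0 < τ →
      ENNReal.ofReal τ⁻¹ * ∫⁻ t in Ioo (0:ℝ) τ, ENNReal.ofReal (t ^ (β - r⁻¹) * ell b0 bi t) ^ r ≤
        C * ENNReal.ofReal (τ ^ (β - r⁻¹) * ell b0 bi τ) ^ r := by
  obtain ⟨K, hK, h⟩ := quasi_incr (β / 2) b0 bi (by positivity)
  have hγ : 0 < r * β / 2 := by positivity
  refine ⟨ENNReal.ofReal (K ^ r / (r * β / 2)), ENNReal.ofReal_ne_top, fun τ hτ => ?_⟩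
  have hE := ell_pos b0 bi hτ
  have hB : 0 ≤ K * (τ ^ (β / 2) * ell b0 bi τ) := by positivity
  have h1 : ∫⁻ t in Ioo (0:ℝ) τ, ENNReal.ofReal (t ^ (β - r⁻¹) * ell b0 bi t) ^ r ≤
      ∫⁻ t in Ioo (0:ℝ) τ, ENNReal.ofReal (t ^ (r * β / 2 - 1)) *
        ENNReal.ofReal ((K * (τ ^ (β / 2) * ell b0 bi τ)) ^ r) := by
    apply setLIntegral_mono' measurableSet_Ioo
    intro t ht
    have ht0 : 0 < t := ht.1
    have hEt := ell_pos b0 bi ht0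
    rw [ENNReal.ofReal_rpow_of_nonneg (by positivity) hr.le, ← ENNReal.ofReal_mul (by positivity)]
    apply ENNReal.ofReal_le_ofReal
    have e1 : t ^ (β - r⁻¹) * ell b0 bi t = t ^ (β / 2 - r⁻¹) * (t ^ (β / 2) * ell b0 bi t) := by
      rw [← mul_assoc, ← Real.rpow_add ht0]; congr 2; ring
    have e2 : t ^ (r * β / 2 - 1) = (t ^ (β / 2 - r⁻¹)) ^ r := by
      rw [← Real.rpow_mul ht0.le]; congr 1; field_simp
    rw [e1, e2, ← Real.mul_rpow (by positivity) hB]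
    apply Real.rpow_le_rpow (by positivity) _ hr.le
    exact mul_le_mul_of_nonneg_left (h t τ ht0 ht.2.le) (by positivity)
  refine (mul_le_mul_right h1 _).trans (le_of_eq ?_)
  rw [lintegral_mul_const' _ _ ENNReal.ofReal_ne_top, lintegral_rpow_Ioo hγ hτ,
    ENNReal.ofReal_rpow_of_nonneg (by positivity) hr.le, ← ENNReal.ofReal_mul (by positivity),
    ← ENNReal.ofReal_mul (by positivity), ← ENNReal.ofReal_mul (by positivity)]
  congr 1
  rw [Real.mul_rpow hK.le (by positivity), Real.mul_rpow (by positivity) hE.le,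
    Real.mul_rpow (by positivity) hE.le, ← Real.rpow_mul hτ.le, ← Real.rpow_mul hτ.le]
  have e3 : τ ^ ((β - r⁻¹) * r) = τ⁻¹ * (τ ^ (r * β / 2) * τ ^ (β / 2 * r)) := by
    rw [← Real.rpow_neg_one τ, ← Real.rpow_add hτ, ← Real.rpow_add hτ]
    congr 1; field_simp; ring
  rw [e3]; ring

lemma rearr_rpow_le {g : ℝ → ℝ≥0∞} {r : ℝ} (hr : 0 < r)
    (H : ∀ t τ, 0 < t → t ≤ τ → τ ≤ 3 * t → g t ≤ 3 * g τ) {t : ℝ} (ht : 0 < t) :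
    rearr g t ^ r ≤ (3 ^ r * 2) * ∫⁻ τ in Ioi t, g τ ^ r * ENNReal.ofReal τ⁻¹ := by
  set J := ∫⁻ τ in Ioi t, g τ ^ r * ENNReal.ofReal τ⁻¹ with hJ
  have key : ∀ s, t ≤ s → g s ^ r ≤ (3 ^ r * 2) * J := by
    intro s hs
    have hs0 : 0 < s := ht.trans_le hs
    have h1 : (g s ^ r * ENNReal.ofReal (3 * s)⁻¹) * ENNReal.ofReal (2 * s) ≤ 3 ^ r * J := by
      calc (g s ^ r * ENNReal.ofReal (3 * s)⁻¹) * ENNReal.ofReal (2 * s)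
          = ∫⁻ τ in Ioc s (3 * s), g s ^ r * ENNReal.ofReal (3 * s)⁻¹ := by
            rw [setLIntegral_const, Real.volume_Ioc]; congr 2; ring
        _ ≤ ∫⁻ τ in Ioc s (3 * s), 3 ^ r * (g τ ^ r * ENNReal.ofReal τ⁻¹) := by
            apply setLIntegral_mono' measurableSet_Ioc
            intro τ hτ
            have hτ0 : 0 < τ := hs0.trans hτ.1
            rw [← mul_assoc, ← ENNReal.mul_rpow_of_nonneg _ _ hr.le]
            apply mul_le_mul'
            · exact ENNReal.rpow_le_rpow (H s τ hs0 hτ.1.le hτ.2) hr.le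
            · apply ENNReal.ofReal_le_ofReal
              exact inv_anti₀ hτ0 hτ.2
        _ = 3 ^ r * ∫⁻ τ in Ioc s (3 * s), g τ ^ r * ENNReal.ofReal τ⁻¹ := by
            rw [lintegral_const_mul' _ _ (ENNReal.rpow_ne_top_of_nonneg hr.le (by norm_num))]
        _ ≤ 3 ^ r * J := by
            gcongr
            exact lintegral_mono_set (fun x hx => hs.trans_lt hx.1)
    calc g s ^ r ≤ g s ^ r * (ENNReal.ofReal (3 * s)⁻¹ * ENNReal.ofReal (2 * s)) * 2 := by
          rw [mul_assoc, ← ENNReal.ofReal_mul (by positivity)]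
          have e : (3 * s)⁻¹ * (2 * s) = 2 / 3 := by field_simp
          have : (1:ℝ≥0∞) ≤ ENNReal.ofReal ((3 * s)⁻¹ * (2 * s)) * 2 := by
            rw [e, show (2:ℝ≥0∞) = ENNReal.ofReal 2 by simp, ← ENNReal.ofReal_mul (by norm_num),
              ← ENNReal.ofReal_one]
            exact ENNReal.ofReal_le_ofReal (by norm_num)
          exact le_mul_of_one_le_right (zero_le) this
      _ ≤ 3 ^ r * J * 2 := by
          rw [← mul_assoc (g s ^ r)]; gcongr
      _ = _ := by ring
  have : rearr g t ≤ ((3 ^ r * 2) * J) ^ r⁻¹ := by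
    apply rearr_le_s10
    intro s hs
    rw [ENNReal.le_rpow_inv_iff hr]
    exact key s hs
  rwa [ENNReal.le_rpow_inv_iff hr] at this

lemma upper_fin {g : ℝ → ℝ≥0∞} (hg : Measurable g) {β b0 bi r : ℝ} {C : ℝ≥0∞} (hr : 0 < r)
    (hC : C ≠ ∞)
    (hCw : ∀ τ : ℝ, 0 < τ →
      ENNReal.ofReal τ⁻¹ * ∫⁻ t in Ioo (0:ℝ) τ, ENNReal.ofReal (t ^ (β - r⁻¹) * ell b0 bi t) ^ r ≤
        C * ENNReal.ofReal (τ ^ (β - r⁻¹) * ell b0 bi τ) ^ r)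
    (H : ∀ t τ, 0 < t → t ≤ τ → τ ≤ 3 * t → g t ≤ 3 * g τ) :
    ∫⁻ t in Ioi (0:ℝ), (ENNReal.ofReal (t ^ (β - r⁻¹) * ell b0 bi t) * rearr g t) ^ r ≤
      (3 ^ r * 2 * C) *
        ∫⁻ t in Ioi (0:ℝ), (ENNReal.ofReal (t ^ (β - r⁻¹) * ell b0 bi t) * g t) ^ r := by
  have h3 : (3:ℝ≥0∞) ^ r * 2 ≠ ∞ :=
    ENNReal.mul_ne_top (ENNReal.rpow_ne_top_of_nonneg hr.le (by norm_num)) (by norm_num)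
  have hW : Measurable (fun t : ℝ => ENNReal.ofReal (t ^ (β - r⁻¹) * ell b0 bi t) ^ r) :=
    (((measurable_id.pow_const _).mul (ell_measurable b0 bi)).ennreal_ofReal).pow_const _
  have hb : Measurable (fun τ : ℝ => g τ ^ r * ENNReal.ofReal τ⁻¹) :=
    (hg.pow_const _).mul measurable_inv.ennreal_ofReal
  calc _ ≤ ∫⁻ t in Ioi (0:ℝ), (3 ^ r * 2) * (ENNReal.ofReal (t ^ (β - r⁻¹) * ell b0 bi t) ^ r *
          ∫⁻ τ in Ioi t, g τ ^ r * ENNReal.ofReal τ⁻¹) := by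
        apply setLIntegral_mono' measurableSet_Ioi
        intro t ht
        rw [ENNReal.mul_rpow_of_nonneg _ _ hr.le]
        refine (mul_le_mul_right (rearr_rpow_le hr H ht) _).trans (le_of_eq ?_)
        ring
    _ = (3 ^ r * 2) * ∫⁻ τ in Ioi (0:ℝ), (g τ ^ r * ENNReal.ofReal τ⁻¹) *
          ∫⁻ t in Ioo (0:ℝ) τ, ENNReal.ofReal (t ^ (β - r⁻¹) * ell b0 bi t) ^ r := by
        rw [lintegral_const_mul' _ _ h3, tonelli_s10 hW hb]
    _ ≤ (3 ^ r * 2) * ∫⁻ τ in Ioi (0:ℝ),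
          C * (ENNReal.ofReal (τ ^ (β - r⁻¹) * ell b0 bi τ) * g τ) ^ r := by
        refine mul_le_mul_right ?_ _
        apply setLIntegral_mono' measurableSet_Ioi
        intro τ hτ
        rw [ENNReal.mul_rpow_of_nonneg _ _ hr.le, mul_assoc]
        refine (mul_le_mul_right (hCw τ hτ) _).trans (le_of_eq ?_)
        ring
    _ = _ := by
        rw [lintegral_const_mul' _ _ hC, ← mul_assoc]

lemma doubleStar_measurable (f : ℝ → ℝ≥0∞) : Measurable (doubleStar f) := by
  unfold doubleStar
  refine (ENNReal.measurable_ofReal.inv).mul (Monotone.measurable ?_)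
  intro x y hxy
  exact lintegral_mono_set (Ioc_subset_Ioc_right hxy)

lemma g_growth (α : ℝ) (hα : 0 ≤ α) (f : ℝ → ℝ≥0∞) (t τ : ℝ) (ht : 0 < t) (h1 : t ≤ τ)
    (h2 : τ ≤ 3 * t) :
    ENNReal.ofReal (t ^ α) * doubleStar f t ≤ 3 * (ENNReal.ofReal (τ ^ α) * doubleStar f τ) := by
  have hτ : 0 < τ := ht.trans_le h1
  unfold doubleStar
  have hI : (∫⁻ s in Ioc (0:ℝ) t, rearr f s) ≤ ∫⁻ s in Ioc (0:ℝ) τ, rearr f s :=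
    lintegral_mono_set (Ioc_subset_Ioc_right h1)
  have hinv : (ENNReal.ofReal t)⁻¹ ≤ 3 * (ENNReal.ofReal τ)⁻¹ := by
    rw [← ENNReal.ofReal_inv_of_pos ht, ← ENNReal.ofReal_inv_of_pos hτ,
      show (3:ℝ≥0∞) = ENNReal.ofReal 3 by simp, ← ENNReal.ofReal_mul (by norm_num)]
    apply ENNReal.ofReal_le_ofReal
    rw [← div_eq_mul_inv, inv_eq_one_div, div_le_div_iff₀ ht hτ]; linarith
  have hpow : ENNReal.ofReal (t ^ α) ≤ ENNReal.ofReal (τ ^ α) :=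
    ENNReal.ofReal_le_ofReal (Real.rpow_le_rpow ht.le h1 hα)
  calc _ ≤ ENNReal.ofReal (τ ^ α) * ((3 * (ENNReal.ofReal τ)⁻¹) *
        ∫⁻ s in Ioc (0:ℝ) τ, rearr f s) := by gcongr
    _ = _ := by ring

lemma conjExp_fin {q : ℝ≥0∞} (hq : 1 ≤ q) (h1 : q ≠ 1) :
    conjExp q ≠ ∞ ∧ 0 < (conjExp q).toReal ∧ (conjExp q).toReal⁻¹ = 1 - q⁻¹.toReal := by
  unfold conjExp
  rw [if_neg h1]
  split_ifs with hi
  · simp [hi]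
  · have hq1 : 1 < q := lt_of_le_of_ne hq (Ne.symm h1)
    have : 1 < q.toReal := by
      rw [← ENNReal.toReal_one]; exact (ENNReal.toReal_lt_toReal (by simp) hi).mpr hq1
    have hp : 0 < q.toReal / (q.toReal - 1) := div_pos (by linarith) (by linarith)
    refine ⟨ENNReal.ofReal_ne_top, ?_, ?_⟩
    · rwa [ENNReal.toReal_ofReal hp.le]
    · rw [ENNReal.toReal_ofReal hp.le, ENNReal.toReal_inv]
      field_simp

/-- description of the associate norm of the optimal Lorentz–Zygmund
target space. -/
theorem statement10 (n m : ℕ) (hn : 2 ≤ n) (hm : 1 ≤ m) (hmn : m < n)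
    (p q : ℝ≥0∞) (a0 ai : ℝ) (hp : 1 ≤ p) (hq : 1 ≤ q)
    (hpnm : p ≤ (n : ℝ≥0∞)/(m : ℝ≥0∞))
    (hcase : (p = 1 ∧ q = 1 ∧ 0 ≤ a0 ∧ ai ≤ 0) ∨ 1 < p) :
    ∃ c C : ℝ≥0∞, 0 < c ∧ c < ∞ ∧ 0 < C ∧ C < ∞ ∧
      ∀ f : ℝ → ℝ≥0∞, Measurable f →
        c * Lqnorm (conjExp q) (Set.Ioi 0)
              (fun t => ENNReal.ofReal
                  (t ^ ((1 - p⁻¹.toReal) - (1 - q⁻¹.toReal) + (m : ℝ)/(n : ℝ)) *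
                    ell (-a0) (-ai) t) * doubleStar f t)
            ≤ Lqnorm (conjExp q) (Set.Ioi 0)
              (fun t => ENNReal.ofReal
                  (t ^ ((1 - p⁻¹.toReal) - (1 - q⁻¹.toReal)) * ell (-a0) (-ai) t) *
                rearr (fun τ => ENNReal.ofReal (τ ^ ((m : ℝ)/(n : ℝ))) * doubleStar f τ) t)
        ∧ Lqnorm (conjExp q) (Set.Ioi 0)
              (fun t => ENNReal.ofReal
                  (t ^ ((1 - p⁻¹.toReal) - (1 - q⁻¹.toReal)) * ell (-a0) (-ai) t) *
                rearr (fun τ => ENNReal.ofReal (τ ^ ((m : ℝ)/(n : ℝ))) * doubleStar f τ) t)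
            ≤ C * Lqnorm (conjExp q) (Set.Ioi 0)
              (fun t => ENNReal.ofReal
                  (t ^ ((1 - p⁻¹.toReal) - (1 - q⁻¹.toReal) + (m : ℝ)/(n : ℝ)) *
                    ell (-a0) (-ai) t) * doubleStar f t) := by
  have hα : (0:ℝ) ≤ (m:ℝ) / n := by positivity
  set α : ℝ := (m:ℝ) / n with hαd
  set β : ℝ := 1 - p⁻¹.toReal with hβd
  set κ : ℝ := 1 - q⁻¹.toReal with hκd
  have hr0 : conjExp q ≠ 0 := by
    by_cases h1 : q = 1
    · simp [conjExp, h1]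
    · intro h0
      have := (conjExp_fin hq h1).2.1
      rw [h0] at this; simp at this
  have hβpos : 1 < p → 0 < β := by
    intro h
    have : p⁻¹ < 1 := ENNReal.inv_lt_one.mpr h
    have := (ENNReal.toReal_lt_toReal (this.trans_le le_top).ne (by simp)).mpr this
    rw [ENNReal.toReal_one] at this
    linarith
  -- the weighted function, rewritten
  have hsplit : ∀ (f : ℝ → ℝ≥0∞) (t : ℝ), 0 < t →
      ENNReal.ofReal (t ^ (β - κ + α) * ell (-a0) (-ai) t) * doubleStar f t =
      ENNReal.ofReal (t ^ (β - κ) * ell (-a0) (-ai) t) *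
        (ENNReal.ofReal (t ^ α) * doubleStar f t) := by
    intro f t ht
    have hE := ell_pos (-a0) (-ai) ht
    rw [← mul_assoc, ← ENNReal.ofReal_mul (by positivity), Real.rpow_add ht]
    congr 2; ring
  have hgm : ∀ f : ℝ → ℝ≥0∞, Measurable (fun τ : ℝ => ENNReal.ofReal (τ ^ α) * doubleStar f τ) :=
    fun f => ((measurable_id.pow_const α).ennreal_ofReal).mul (doubleStar_measurable f)
  -- the upper estimate
  have hup : ∃ C : ℝ≥0∞, C ≠ ∞ ∧ ∀ f : ℝ → ℝ≥0∞,
      Lqnorm (conjExp q) (Set.Ioi 0)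
        (fun t => ENNReal.ofReal (t ^ (β - κ) * ell (-a0) (-ai) t) *
          rearr (fun τ => ENNReal.ofReal (τ ^ α) * doubleStar f τ) t) ≤
      C * Lqnorm (conjExp q) (Set.Ioi 0)
        (fun t => ENNReal.ofReal (t ^ (β - κ) * ell (-a0) (-ai) t) *
          (ENNReal.ofReal (t ^ α) * doubleStar f t)) := by
    by_cases h1 : q = 1
    · have hκ : κ = 0 := by simp [hκd, h1]
      have hK : ∃ K : ℝ, ∀ t s : ℝ, 0 < t → t ≤ s →
          t ^ β * ell (-a0) (-ai) t ≤ K * (s ^ β * ell (-a0) (-ai) s) := by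
        rcases hcase with ⟨hp1, -, h0, hi⟩ | hp1
        · refine ⟨1, fun t s ht hts => ?_⟩
          have : β = 0 := by simp [hβd, hp1]
          rw [this, Real.rpow_zero, Real.rpow_zero, one_mul, one_mul, one_mul]
          exact quasi_incr_zero _ _ (by linarith) (by linarith) ht hts
        · obtain ⟨K, -, hK⟩ := quasi_incr β (-a0) (-ai) (hβpos hp1)
          exact ⟨K, hK⟩
      obtain ⟨K, hK⟩ := hK
      refine ⟨3 * ENNReal.ofReal K, ENNReal.mul_ne_top (by norm_num) ENNReal.ofReal_ne_top,
        fun f => ?_⟩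
      have hc : conjExp q = ∞ := by simp [conjExp, h1]
      rw [hc]
      simp only [Lqnorm, if_true]
      refine upper_top (g_growth α hα f) ?_
      intro t s ht hts
      have hs : 0 < s := ht.trans_le hts
      have hE := ell_pos (-a0) (-ai) hs
      rw [hκ, sub_zero, ← ENNReal.ofReal_mul' (by positivity)]
      exact ENNReal.ofReal_le_ofReal (hK t s ht hts)
    · obtain ⟨hri, hrp, hrinv⟩ := conjExp_fin hq h1
      have hp1 : 1 < p := by
        rcases hcase with ⟨-, h, -⟩ | h
        · exact absurd h h1
        · exact h
      set r := (conjExp q).toReal with hrd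
      obtain ⟨C, hC, hCw⟩ := weight_int β (-a0) (-ai) r (hβpos hp1) hrp
      have h3 : (3:ℝ≥0∞) ^ r * 2 * C ≠ ∞ :=
        ENNReal.mul_ne_top (ENNReal.mul_ne_top
          (ENNReal.rpow_ne_top_of_nonneg hrp.le (by norm_num)) (by norm_num)) hC
      refine ⟨((3:ℝ≥0∞) ^ r * 2 * C) ^ (1 / r),
        ENNReal.rpow_ne_top_of_nonneg (by positivity) h3, fun f => ?_⟩
      have := upper_fin (hgm f) hrp hC hCw (g_growth α hα f)
      rw [hrinv] at this
      simp only [Lqnorm, if_neg hri]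
      rw [← ENNReal.mul_rpow_of_nonneg _ _ (by positivity)]
      exact ENNReal.rpow_le_rpow this (by positivity)
  obtain ⟨C, hC, hCf⟩ := hup
  refine ⟨3⁻¹, C + 1, by simp, by simp, by simp, by simpa using hC.lt_top, fun f _ => ⟨?_, ?_⟩⟩
  · have : Lqnorm (conjExp q) (Set.Ioi 0)
        (fun t => ENNReal.ofReal (t ^ (β - κ + α) * ell (-a0) (-ai) t) * doubleStar f t) ≤
        3 * Lqnorm (conjExp q) (Set.Ioi 0)
        (fun t => ENNReal.ofReal (t ^ (β - κ) * ell (-a0) (-ai) t) *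
          rearr (fun τ => ENNReal.ofReal (τ ^ α) * doubleStar f τ) t) := by
      apply Lq_le (by norm_num) hr0
      intro t ht
      rw [hsplit f t ht]
      refine (mul_le_mul_right (le_rearr (g_growth α hα f) ht) _).trans (le_of_eq ?_)
      ring
    rw [mul_comm, ← div_eq_mul_inv,
      ENNReal.div_le_iff_le_mul (Or.inl (by norm_num)) (Or.inl (by norm_num)), mul_comm]
    exact this
  · refine (hCf f).trans (mul_le_mul' le_self_add ?_)
    rw [← one_mul (Lqnorm (conjExp q) (Set.Ioi 0) fun t =>
      ENNReal.ofReal (t ^ (β - κ + α) * ell (-a0) (-ai) t) * doubleStar f t)]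
    apply Lq_le (by simp) hr0
    intro t ht
    rw [hsplit f t ht, one_mul]

end
end
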